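/- arXiv:1404.3339 — 2 statements merged into one kernel-verified Lean document; each statement's English description precedes it below -/
import Mathlib

section
/- Suppose P is an SP-graded Kantor pair over 𝕂. Then there exists a unique ℤ²-grading 𝔎(P) = ⊕_{(i,j)∈ℤ²} 𝔎(P)_{i,j} of the Lie algebra 𝔎(P) whose support is contained in the BC₂ root set {±(1,0), ±(1,1), ±(2,0), ±(2,1), ±(2,2), ±(0,1)} ∪ {(0,0)} and which satisfies 𝔎(P)_{σ1,σi} = P_i^σ for σ = ±, i ∈ ℤ (identifying P^σ with the corresponding part of 𝔎(P)). Moreover, for σ = ±: 𝔎(P)_{σ2,σ2i} = [P_i^σ, P_i^σ] for i = 0,1; 𝔎(P)_{σ2,σ1} = [P_0^σ, P_1^σ]; 𝔎(P)_{0,σ1} = [P_1^σ, P_0^{−σ}]; and 𝔎(P)_{0,0} = Σ_{j=0,1} [P_j^σ, P_j^{−σ}]. Finally, the first component grading 𝔎(P) = ⊕_i (⊕_j 𝔎(P)_{i,j}) is the standard 5-grading of 𝔎(P). -/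
/-- A Kantor pair over `K`: a pair of modules `(Pm, Pp)` (for `P⁻`, `P⁺`) with trilinear
products `tm : P⁻ × P⁺ × P⁻ → P⁻` and `tp : P⁺ × P⁻ × P⁺ → P⁺` satisfying the Kantor
identities (K1) and (K2). -/
structure KantorPair (K : Type*) [CommRing K] (Pm Pp : Type*)
    [AddCommGroup Pm] [AddCommGroup Pp] [Module K Pm] [Module K Pp] where
  tm : Pm → Pp → Pm → Pm
  tp : Pp → Pm → Pp → Pp
  tm_add₁ : ∀ x x' y z, tm (x + x') y z = tm x y z + tm x' y z
  tm_smul₁ : ∀ (a : K) x y z, tm (a • x) y z = a • tm x y z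
  tm_add₂ : ∀ x y y' z, tm x (y + y') z = tm x y z + tm x y' z
  tm_smul₂ : ∀ (a : K) x y z, tm x (a • y) z = a • tm x y z
  tm_add₃ : ∀ x y z z', tm x y (z + z') = tm x y z + tm x y z'
  tm_smul₃ : ∀ (a : K) x y z, tm x y (a • z) = a • tm x y z
  tp_add₁ : ∀ x x' y z, tp (x + x') y z = tp x y z + tp x' y z
  tp_smul₁ : ∀ (a : K) x y z, tp (a • x) y z = a • tp x y z
  tp_add₂ : ∀ x y y' z, tp x (y + y') z = tp x y z + tp x y' z
  tp_smul₂ : ∀ (a : K) x y z, tp x (a • y) z = a • tp x y z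
  tp_add₃ : ∀ x y z z', tp x y (z + z') = tp x y z + tp x y z'
  tp_smul₃ : ∀ (a : K) x y z, tp x y (a • z) = a • tp x y z
  k1m : ∀ (x z u : Pm) (y w : Pp),
    tm x y (tm z w u) - tm z w (tm x y u) = tm (tm x y z) w u - tm z (tp y x w) u
  k1p : ∀ (x z u : Pp) (y w : Pm),
    tp x y (tp z w u) - tp z w (tp x y u) = tp (tp x y z) w u - tp z (tm y x w) u
  k2m : ∀ (x z u : Pm) (w v : Pp),
    (tm x (tp w u v) z - tm z (tp w u v) x) + tm u w (tm x v z - tm z v x)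
      = tm (tm x w z - tm z w x) v u - tm u v (tm x w z - tm z w x)
  k2p : ∀ (x z u : Pp) (w v : Pm),
    (tp x (tm w u v) z - tp z (tm w u v) x) + tp u w (tp x v z - tp z v x)
      = tp (tp x w z - tp z w x) v u - tp u v (tp x w z - tp z w x)

namespace KantorPair

variable {K : Type*} [CommRing K] {Pm Pp : Type*}
  [AddCommGroup Pm] [AddCommGroup Pp] [Module K Pm] [Module K Pp]

/-- `Q = (Qm, Qp)` is an ideal of the Kantor pair:
`{P,P,Q} + {P,Q,P} + {Q,P,P} ⊆ Q` on each side. -/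
def IsIdealPair (KP : KantorPair K Pm Pp) (Qm : Submodule K Pm) (Qp : Submodule K Pp) : Prop :=
  (∀ (x z : Pm) (y : Pp) (q : Pm), q ∈ Qm → KP.tm x y q ∈ Qm ∧ KP.tm q y z ∈ Qm) ∧
  (∀ (x z : Pm) (r : Pp), r ∈ Qp → KP.tm x r z ∈ Qm) ∧
  (∀ (x z : Pp) (y : Pm) (q : Pp), q ∈ Qp → KP.tp x y q ∈ Qp ∧ KP.tp q y z ∈ Qp) ∧
  (∀ (x z : Pp) (r : Pm), r ∈ Qm → KP.tp x r z ∈ Qp)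

/-- A Kantor pair is simple if some product is nonzero and its only ideals are `0` and `P`. -/
def IsSimplePair (KP : KantorPair K Pm Pp) : Prop :=
  ((∃ x y z, KP.tm x y z ≠ 0) ∨ (∃ x y z, KP.tp x y z ≠ 0)) ∧
  ∀ Qm Qp, KP.IsIdealPair Qm Qp → (Qm = ⊥ ∧ Qp = ⊥) ∨ (Qm = ⊤ ∧ Qp = ⊤)

/-- `(ωm, ωp)` belongs to the centroid of the Kantor pair. -/
def InCentroid (KP : KantorPair K Pm Pp) (ωm : Pm →ₗ[K] Pm) (ωp : Pp →ₗ[K] Pp) : Prop :=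
  (∀ x y z, ωm (KP.tm x y z) = KP.tm (ωm x) y z ∧
      ωm (KP.tm x y z) = KP.tm x (ωp y) z ∧ ωm (KP.tm x y z) = KP.tm x y (ωm z)) ∧
  (∀ x y z, ωp (KP.tp x y z) = KP.tp (ωp x) y z ∧
      ωp (KP.tp x y z) = KP.tp x (ωm y) z ∧ ωp (KP.tp x y z) = KP.tp x y (ωp z))

/-- The Kantor pair is central: `a ↦ (a • id, a • id)` is an isomorphism of `K`
onto the centroid. -/
def IsCentralPair (KP : KantorPair K Pm Pp) : Prop :=
  (∀ ωm ωp, KP.InCentroid ωm ωp →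
    ∃ a : K, ωm = a • (LinearMap.id : Pm →ₗ[K] Pm) ∧ ωp = a • (LinearMap.id : Pp →ₗ[K] Pp)) ∧
  ∀ a : K, a • (LinearMap.id : Pm →ₗ[K] Pm) = 0 →
    a • (LinearMap.id : Pp →ₗ[K] Pp) = 0 → a = 0

/-- A Jordan pair is a Kantor pair with vanishing K-operators, i.e. symmetric products. -/
def IsJordanPair (KP : KantorPair K Pm Pp) : Prop :=
  (∀ (x z : Pm) (y : Pp), KP.tm x y z = KP.tm z y x) ∧
  (∀ (x z : Pp) (y : Pm), KP.tp x y z = KP.tp z y x)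

end KantorPair

/-- A 5-grading (= BC₁-grading) of a Lie algebra `L` over `K`:
an internal direct sum decomposition `L = ⊕_{i ∈ ℤ} L_i` with `⁅L_i, L_j⁆ ⊆ L_{i+j}`
and `L_i = 0` for `|i| > 2`. -/
structure FiveGrading (K : Type*) [CommRing K] (L : Type*) [LieRing L] [LieAlgebra K L] where
  g : ℤ → Submodule K L
  internal : DirectSum.IsInternal g
  lie_mem : ∀ (i j : ℤ) (x y : L), x ∈ g i → y ∈ g j → ⁅x, y⁆ ∈ g (i + j)
  vanish : ∀ i : ℤ, 2 < |i| → g i = ⊥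

/-- `T_L(P) = L_{-1} ⊕ L_1` as a submodule of `L`. -/
def Tsub {K : Type*} [CommRing K] {L : Type*} [LieRing L] [LieAlgebra K L]
    (fg : FiveGrading K L) : Submodule K L :=
  fg.g (-1) ⊔ fg.g 1

/-- The span of all brackets `⁅x, y⁆` with `x ∈ U`, `y ∈ V`. -/
def brkSpan (K : Type*) [CommRing K] {L : Type*} [LieRing L] [LieAlgebra K L]
    (U V : Submodule K L) : Submodule K L :=
  Submodule.span K {w : L | ∃ x ∈ U, ∃ y ∈ V, w = ⁅x, y⁆}

/-- A 5-graded Lie algebra `L` tightly envelops the Kantor pair `(L_{-1}, L_1)` if it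
is generated as a Lie algebra by `T = L_{-1} ⊕ L_1` and `Z(L) ∩ [T, T] = 0`. -/
def Tight (K : Type*) [CommRing K] {L : Type*} [LieRing L] [LieAlgebra K L]
    (fg : FiveGrading K L) : Prop :=
  LieSubalgebra.lieSpan K L ↑(Tsub fg) = ⊤ ∧
  ∀ z ∈ brkSpan K (Tsub fg) (Tsub fg), (∀ u : L, ⁅z, u⁆ = 0) → z = 0

/-- A 5-graded Lie algebra `(L, fg)` envelops a Kantor pair `KP`: there are identifications
of `P⁻` with `L_{-1}` and `P⁺` with `L_1` under which the products of `KP` are the products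
`⁅⁅x, y⁆, z⁆` of `L`. -/
structure Envelops {K : Type*} [CommRing K] {Pm Pp : Type*}
    [AddCommGroup Pm] [AddCommGroup Pp] [Module K Pm] [Module K Pp]
    (KP : KantorPair K Pm Pp)
    {L : Type*} [LieRing L] [LieAlgebra K L] (fg : FiveGrading K L) where
  em : Pm →ₗ[K] L
  ep : Pp →ₗ[K] L
  inj_m : Function.Injective em
  inj_p : Function.Injective ep
  range_m : LinearMap.range em = fg.g (-1)
  range_p : LinearMap.range ep = fg.g 1
  compat_m : ∀ (x z : Pm) (y : Pp), em (KP.tm x y z) = ⁅⁅em x, ep y⁆, em z⁆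
  compat_p : ∀ (x z : Pp) (y : Pm), ep (KP.tp x y z) = ⁅⁅ep x, em y⁆, ep z⁆

/-- A short Peirce grading (SP-grading) of a Kantor pair: a `ℤ`-grading with support
contained in `{0, 1}`. -/
structure SPGrading {K : Type*} [CommRing K] {Pm Pp : Type*}
    [AddCommGroup Pm] [AddCommGroup Pp] [Module K Pm] [Module K Pp]
    (KP : KantorPair K Pm Pp) where
  Qm : ℤ → Submodule K Pm
  Qp : ℤ → Submodule K Pp
  sup_m : Qm 0 ⊔ Qm 1 = ⊤
  disj_m : Disjoint (Qm 0) (Qm 1)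
  sup_p : Qp 0 ⊔ Qp 1 = ⊤
  disj_p : Disjoint (Qp 0) (Qp 1)
  vanish_m : ∀ i : ℤ, i ≠ 0 → i ≠ 1 → Qm i = ⊥
  vanish_p : ∀ i : ℤ, i ≠ 0 → i ≠ 1 → Qp i = ⊥
  grade_m : ∀ (i j k : ℤ) (x : Pm) (y : Pp) (z : Pm),
    x ∈ Qm i → y ∈ Qp j → z ∈ Qm k → KP.tm x y z ∈ Qm (i - j + k)
  grade_p : ∀ (i j k : ℤ) (x : Pp) (y : Pm) (z : Pp),
    x ∈ Qp i → y ∈ Qm j → z ∈ Qp k → KP.tp x y z ∈ Qp (i - j + k)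

/-- `KPc` is the reflection `P̌` of the SP-graded Kantor pair `(KP, SP)`:
`P̌^σ = P₀^{-σ} ⊕ P₁^σ`, with products given by the reflection formula. -/
def IsReflection {K : Type*} [CommRing K] {Pm Pp : Type*}
    [AddCommGroup Pm] [AddCommGroup Pp] [Module K Pm] [Module K Pp]
    (KP : KantorPair K Pm Pp) (SP : SPGrading KP)
    (KPc : KantorPair K ((SP.Qp 0) × (SP.Qm 1)) ((SP.Qm 0) × (SP.Qp 1))) : Prop :=
  (∀ (a c : (SP.Qm 0) × (SP.Qp 1)) (b : (SP.Qp 0) × (SP.Qm 1)),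
    ((KPc.tp a b c).1 : Pm)
      = KP.tm a.1 b.1 c.1 - KP.tm b.2 a.2 c.1 + (KP.tm a.1 c.2 b.2 - KP.tm b.2 c.2 a.1) ∧
    ((KPc.tp a b c).2 : Pp)
      = KP.tp a.2 b.2 c.2 - KP.tp b.1 a.1 c.2 + (KP.tp a.2 c.1 b.1 - KP.tp b.1 c.1 a.2)) ∧
  (∀ (a c : (SP.Qp 0) × (SP.Qm 1)) (b : (SP.Qm 0) × (SP.Qp 1)),
    ((KPc.tm a b c).1 : Pp)
      = KP.tp a.1 b.1 c.1 - KP.tp b.2 a.2 c.1 + (KP.tp a.1 c.2 b.2 - KP.tp b.2 c.2 a.1) ∧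
    ((KPc.tm a b c).2 : Pm)
      = KP.tm a.2 b.2 c.2 - KP.tm b.1 a.1 c.2 + (KP.tm a.2 c.1 b.1 - KP.tm b.1 c.1 a.2))

/-- The set `Δ ∪ {0}` for the root system `Δ` of type BC₂ (coordinates in the base
`{α₁, α₂}`). -/
def BC2Support : Set (ℤ × ℤ) :=
  {(1,0), (1,1), (2,0), (2,1), (2,2), (0,1),
   (-1,0), (-1,-1), (-2,0), (-2,-1), (-2,-2), (0,-1), (0,0)}

/-- `h` is a BC₂-grading of `L` with `L_{σ1,σi} = P_i^σ` (i.e. condition (17)). -/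
def IsStdBC2Grading {K : Type*} [CommRing K] {Pm Pp : Type*}
    [AddCommGroup Pm] [AddCommGroup Pp] [Module K Pm] [Module K Pp]
    {KP : KantorPair K Pm Pp} (SP : SPGrading KP)
    {L : Type*} [LieRing L] [LieAlgebra K L] {fg : FiveGrading K L}
    (E : Envelops KP fg) (h : ℤ × ℤ → Submodule K L) : Prop :=
  (⨆ v : ℤ × ℤ, h v) = ⊤ ∧
  (∀ v : ℤ × ℤ, Disjoint (h v) (⨆ w : ℤ × ℤ, ⨆ _ : w ≠ v, h w)) ∧
  (∀ (v w : ℤ × ℤ) (x y : L), x ∈ h v → y ∈ h w → ⁅x, y⁆ ∈ h (v + w)) ∧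
  (∀ v : ℤ × ℤ, v ∉ BC2Support → h v = ⊥) ∧
  (∀ i : ℤ, h (1, i) = (SP.Qp i).map E.ep) ∧
  (∀ i : ℤ, h (-1, -i) = (SP.Qm i).map E.em)

namespace BC2Aux

theorem mem_brkSpan {K : Type*} [CommRing K] {L : Type*} [LieRing L] [LieAlgebra K L]
    {U V : Submodule K L} {x y : L} (hx : x ∈ U) (hy : y ∈ V) : ⁅x, y⁆ ∈ brkSpan K U V :=
  Submodule.subset_span ⟨x, hx, y, hy, rfl⟩

theorem brkSpan_le {K : Type*} [CommRing K] {L : Type*} [LieRing L] [LieAlgebra K L]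
    {U V W : Submodule K L} (h : ∀ x ∈ U, ∀ y ∈ V, ⁅x, y⁆ ∈ W) : brkSpan K U V ≤ W := by
  refine Submodule.span_le.2 ?_
  rintro _ ⟨x, hx, y, hy, rfl⟩
  exact h x hx y hy

/-- independence of a doubly indexed family from independence of rows -/
theorem indep_of_rows {K : Type*} [CommRing K] {L : Type*} [AddCommGroup L] [Module K L]
    {g : ℤ → Submodule K L} (hg : iSupIndep g) {H : ℤ × ℤ → Submodule K L}
    (hle : ∀ v, H v ≤ g v.1) (hr : ∀ i, iSupIndep fun j => H (i, j)) : iSupIndep H := by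
  classical
  rw [iSupIndep_iff_finsetSum_eq_zero_imp_eq_zero] at hg ⊢
  intro s x hx h0 v hv
  have h1 : ∀ i ∈ s.image Prod.fst, ∑ p ∈ s with p.1 = i, x p = 0 := by
    apply hg (s.image Prod.fst) (fun i => ∑ p ∈ s with p.1 = i, x p)
    · intro i _
      refine Submodule.sum_mem _ ?_
      intro p hp
      rw [Finset.mem_filter] at hp
      have := hle p (hx p hp.1)
      rwa [hp.2] at this
    · rw [Finset.sum_fiberwise_of_maps_to (fun p hp => Finset.mem_image_of_mem _ hp), h0]
  have h2 := h1 v.1 (Finset.mem_image_of_mem _ hv)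
  have h3 := hr v.1
  rw [iSupIndep_iff_finsetSum_eq_zero_imp_eq_zero] at h3
  have h4 := h3 ((s.filter fun p => p.1 = v.1).image Prod.snd) (fun j => x (v.1, j)) ?_ ?_ v.2 ?_
  · exact h4
  · intro j hj
    simp only [Finset.mem_image, Finset.mem_filter] at hj
    obtain ⟨p, ⟨hp, hp1⟩, rfl⟩ := hj
    rw [← hp1]
    exact hx p hp
  · rw [Finset.sum_image, ← h2]
    · refine Finset.sum_congr rfl ?_
      intro p hp
      rw [Finset.mem_filter] at hp
      rw [← hp.2]
    · intro p hp q hq hpq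
      simp only [Finset.coe_filter, Set.mem_ofPred_eq] at hp hq
      exact Prod.ext (hp.2.trans hq.2.symm) hpq
  · exact Finset.mem_image_of_mem _ (by simp [hv])

theorem indep_two {K : Type*} [CommRing K] {L : Type*} [AddCommGroup L] [Module K L]
    {Q : ℤ → Submodule K L} (a b : ℤ) (hd : Disjoint (Q a) (Q b))
    (hv : ∀ i, i ≠ a → i ≠ b → Q i = ⊥) : iSupIndep Q := by
  intro i
  by_cases ha : i = a
  · subst ha
    refine hd.mono_right (iSup₂_le fun j hj => ?_)
    by_cases hb : j = b
    · rw [hb]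
    · rw [hv j hj hb]; exact bot_le
  by_cases hb : i = b
  · subst hb
    refine hd.symm.mono_right (iSup₂_le fun j hj => ?_)
    by_cases ha : j = a
    · rw [ha]
    · rw [hv j ha hj]; exact bot_le
  rw [hv i ha hb]
  exact disjoint_bot_left

section

variable {K : Type*} [CommRing K]
    {Pm Pp : Type*} [AddCommGroup Pm] [AddCommGroup Pp] [Module K Pm] [Module K Pp]
    {KP : KantorPair K Pm Pp} (SP : SPGrading KP)
    {L : Type*} [LieRing L] [LieAlgebra K L] {fg : FiveGrading K L}
    (E : Envelops KP fg)

/-- the odd part of the grading -/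
def T (v : ℤ × ℤ) : Submodule K L :=
  if v.1 = 1 then (SP.Qp v.2).map E.ep else if v.1 = -1 then (SP.Qm (-v.2)).map E.em else ⊥

theorem T_pos {v : ℤ × ℤ} (h : v.1 = 1) : T SP E v = (SP.Qp v.2).map E.ep := by
  simp [T, h]

theorem T_neg {v : ℤ × ℤ} (h : v.1 = -1) : T SP E v = (SP.Qm (-v.2)).map E.em := by
  simp [T, h]

theorem T_bot {v : ℤ × ℤ} (h : v.1 ≠ 1) (h' : v.1 ≠ -1) : T SP E v = ⊥ := by
  simp [T, h, h']

theorem T_cases {v : ℤ × ℤ} {x : L} (hx : x ∈ T SP E v) :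
    (v.1 = 1 ∧ ∃ a ∈ SP.Qp v.2, E.ep a = x) ∨ (v.1 = -1 ∧ ∃ a ∈ SP.Qm (-v.2), E.em a = x) ∨
      x = 0 := by
  by_cases h : v.1 = 1
  · rw [T_pos SP E h] at hx
    exact Or.inl ⟨h, hx⟩
  by_cases h' : v.1 = -1
  · rw [T_neg SP E h'] at hx
    exact Or.inr (Or.inl ⟨h', hx⟩)
  rw [T_bot SP E h h'] at hx
  exact Or.inr (Or.inr hx)

theorem ep_mem_g (a : Pp) : E.ep a ∈ fg.g 1 := E.range_p ▸ LinearMap.mem_range_self _ a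
theorem em_mem_g (a : Pm) : E.em a ∈ fg.g (-1) := E.range_m ▸ LinearMap.mem_range_self _ a

theorem T_le_g (v : ℤ × ℤ) : T SP E v ≤ fg.g v.1 := by
  intro x hx
  rcases T_cases SP E hx with ⟨h, a, -, rfl⟩ | ⟨h, a, -, rfl⟩ | rfl
  · rw [h]; exact ep_mem_g E a
  · rw [h]; exact em_mem_g E a
  · exact zero_mem _

theorem T_le_Tsub (v : ℤ × ℤ) : T SP E v ≤ Tsub fg := by
  intro x hx
  rcases T_cases SP E hx with ⟨h, a, -, rfl⟩ | ⟨h, a, -, rfl⟩ | rfl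
  · exact Submodule.mem_sup_right (ep_mem_g E a)
  · exact Submodule.mem_sup_left (em_mem_g E a)
  · exact zero_mem _

theorem ep_mem_T {j : ℤ} {a : Pp} (ha : a ∈ SP.Qp j) {v : ℤ × ℤ} (hv : v = (1, j)) :
    E.ep a ∈ T SP E v := by
  subst hv
  rw [T_pos SP E rfl]
  exact Submodule.mem_map_of_mem ha

theorem em_mem_T {j : ℤ} {a : Pm} (ha : a ∈ SP.Qm j) {v : ℤ × ℤ} (hv : v = (-1, -j)) :
    E.em a ∈ T SP E v := by
  subst hv
  rw [T_neg SP E rfl]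
  exact Submodule.mem_map_of_mem (by simpa using ha)

theorem g_zero {fg : FiveGrading K L} {i : ℤ} (hi : 2 < |i|) {x : L} (hx : x ∈ fg.g i) :
    x = 0 := by
  rw [fg.vanish i hi] at hx
  exact hx

/-- same sign in positions one and three, opposite sign in the middle -/
theorem key_alt {v w u : ℤ × ℤ} (hvw : v.1 + w.1 = 0) (hvu : v.1 = u.1) {x y z : L}
    (hx : x ∈ T SP E v) (hy : y ∈ T SP E w) (hz : z ∈ T SP E u) :
    ⁅⁅x, y⁆, z⁆ ∈ T SP E (v + w + u) := by
  rcases T_cases SP E hx with ⟨h, a, ha, rfl⟩ | ⟨h, a, ha, rfl⟩ | rfl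
  · rcases T_cases SP E hy with ⟨h', b, hb, rfl⟩ | ⟨h', b, hb, rfl⟩ | rfl
    · omega
    · rcases T_cases SP E hz with ⟨h'', c, hc, rfl⟩ | ⟨h'', c, hc, rfl⟩ | rfl
      · rw [← E.compat_p]
        refine ep_mem_T SP E (SP.grade_p _ _ _ _ _ _ ha hb hc) (Prod.ext ?_ ?_)
        · simp; omega
        · simp
      · omega
      · simp
    · simp
  · rcases T_cases SP E hy with ⟨h', b, hb, rfl⟩ | ⟨h', b, hb, rfl⟩ | rfl
    · rcases T_cases SP E hz with ⟨h'', c, hc, rfl⟩ | ⟨h'', c, hc, rfl⟩ | rfl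
      · omega
      · rw [← E.compat_m]
        refine em_mem_T SP E (SP.grade_m _ _ _ _ _ _ ha hb hc) (Prod.ext ?_ ?_)
        · simp; omega
        · simp; ring
      · simp
    · omega
    · simp
  · simp

theorem key {v w u : ℤ × ℤ} {x y z : L}
    (hx : x ∈ T SP E v) (hy : y ∈ T SP E w) (hz : z ∈ T SP E u) :
    ⁅⁅x, y⁆, z⁆ ∈ T SP E (v + w + u) := by
  have oddc : ∀ {v : ℤ × ℤ} {x : L}, x ∈ T SP E v → x = 0 ∨ v.1 = 1 ∨ v.1 = -1 := by
    intro v x hx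
    rcases T_cases SP E hx with ⟨h, -⟩ | ⟨h, -⟩ | h
    · exact Or.inr (Or.inl h)
    · exact Or.inr (Or.inr h)
    · exact Or.inl h
  rcases oddc hx with rfl | hv
  · simp
  rcases oddc hy with rfl | hw
  · simp
  rcases oddc hz with rfl | hu
  · simp
  by_cases h1 : v.1 + w.1 = 0
  · by_cases h2 : v.1 = u.1
    · exact key_alt SP E h1 h2 hx hy hz
    · rw [← lie_skew x y, neg_lie, add_comm v w]
      exact neg_mem (key_alt SP E (by omega) (by omega) hy hx hz)
  · have h1' : v.1 = w.1 := by omega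
    by_cases h2 : v.1 = u.1
    · have : ⁅⁅x, y⁆, z⁆ = 0 := by
        refine g_zero (fg := fg) (i := v.1 + w.1 + u.1) ?_
          (fg.lie_mem _ _ _ _ (fg.lie_mem _ _ _ _ (T_le_g SP E v hx) (T_le_g SP E w hy))
            (T_le_g SP E u hz))
        rcases hv with hv | hv
        · have : v.1 + w.1 + u.1 = 3 := by omega
          rw [this]; norm_num
        · have : v.1 + w.1 + u.1 = -3 := by omega
          rw [this]; norm_num
      rw [this]; exact zero_mem _
    · have e : ⁅⁅x, y⁆, z⁆ = ⁅⁅x, z⁆, y⁆ - ⁅⁅y, z⁆, x⁆ := by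
        rw [lie_lie x y z, ← lie_skew x ⁅y, z⁆, ← lie_skew y ⁅x, z⁆]
        abel
      rw [e]
      have a1 := key_alt SP E (by omega) h1' hx hz hy
      have a2 := key_alt SP E (by omega) h1'.symm hy hz hx
      have e1 : v + w + u = v + u + w := by abel
      have e2 : w + u + v = v + u + w := by abel
      rw [e1]
      rw [e2] at a2
      exact sub_mem a1 a2

/-- normalizing part -/
def N (v : ℤ × ℤ) : Submodule K L where
  carrier := {x | x ∈ fg.g v.1 ∧ ∀ (w : ℤ × ℤ) (y : L), y ∈ T SP E w → ⁅x, y⁆ ∈ T SP E (v + w)}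
  add_mem' := by
    rintro a b ⟨ha, ha'⟩ ⟨hb, hb'⟩
    refine ⟨add_mem ha hb, fun w y hy => ?_⟩
    rw [add_lie]
    exact add_mem (ha' w y hy) (hb' w y hy)
  zero_mem' := ⟨zero_mem _, fun w y _ => by simp⟩
  smul_mem' := by
    rintro c a ⟨ha, ha'⟩
    refine ⟨Submodule.smul_mem _ _ ha, fun w y hy => ?_⟩
    rw [smul_lie]
    exact Submodule.smul_mem _ _ (ha' w y hy)

/-- the grading, intrinsically -/
def H (v : ℤ × ℤ) : Submodule K L :=
  if v.1 = 1 ∨ v.1 = -1 then T SP E v else N SP E v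

theorem H_odd {v : ℤ × ℤ} (h : v.1 = 1 ∨ v.1 = -1) : H SP E v = T SP E v := by simp [H, h]
theorem H_even {v : ℤ × ℤ} (h : ¬ (v.1 = 1 ∨ v.1 = -1)) : H SP E v = N SP E v := by
  rw [H, if_neg h]

theorem H_le_g (v : ℤ × ℤ) : H SP E v ≤ fg.g v.1 := by
  by_cases h : v.1 = 1 ∨ v.1 = -1
  · rw [H_odd SP E h]; exact T_le_g SP E v
  · rw [H_even SP E h]; exact fun x hx => hx.1

theorem H_lie (v w : ℤ × ℤ) (x y : L) (hx : x ∈ H SP E v) (hy : y ∈ H SP E w) :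
    ⁅x, y⁆ ∈ H SP E (v + w) := by
  by_cases bv : 2 < |v.1|
  · rw [g_zero bv (H_le_g SP E v hx)]; simp
  by_cases bw : 2 < |w.1|
  · rw [g_zero bw (H_le_g SP E w hy)]; simp
  have hg : ⁅x, y⁆ ∈ fg.g (v + w).1 :=
    fg.lie_mem _ _ _ _ (H_le_g SP E v hx) (H_le_g SP E w hy)
  have key2 : ∀ z ∈ T SP E (v + w), z ∈ H SP E (v + w) := by
    intro z hz
    by_cases h : (v + w).1 = 1 ∨ (v + w).1 = -1
    · rwa [H_odd SP E h]
    · rw [T_bot SP E (fun e => h (Or.inl e)) (fun e => h (Or.inr e))] at hz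
      rw [(Submodule.mem_bot K).1 hz]; exact zero_mem _
  by_cases hv : v.1 = 1 ∨ v.1 = -1
  · rw [H_odd SP E hv] at hx
    by_cases hw : w.1 = 1 ∨ w.1 = -1
    · rw [H_odd SP E hw] at hy
      rw [H_even SP E (by simp only [Prod.fst_add]; omega)]
      exact ⟨hg, fun u z hz => key SP E hx hy hz⟩
    · rw [H_even SP E hw] at hy
      apply key2
      rw [← lie_skew, add_comm]
      exact neg_mem (hy.2 v x hx)
  · rw [H_even SP E hv] at hx
    by_cases hw : w.1 = 1 ∨ w.1 = -1
    · rw [H_odd SP E hw] at hy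
      apply key2
      exact hx.2 w y hy
    · rw [H_even SP E hw] at hy
      have b1 := abs_le.1 (not_lt.1 bv)
      have b2 := abs_le.1 (not_lt.1 bw)
      rw [H_even SP E (by simp only [Prod.fst_add]; omega)]
      refine ⟨hg, fun u z hz => ?_⟩
      rw [lie_lie]
      have e1 : v + w + u = v + (w + u) := by abel
      have e2 : w + (v + u) = v + (w + u) := by abel
      have a1 := hx.2 _ _ (hy.2 _ _ hz)
      have a2 := hy.2 _ _ (hx.2 _ _ hz)
      rw [e2] at a2
      rw [e1]
      exact sub_mem a1 a2

theorem T_supp {v : ℤ × ℤ} {x : L} (hx : x ∈ T SP E v) :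
    x = 0 ∨ v = (1, 0) ∨ v = (1, 1) ∨ v = (-1, 0) ∨ v = (-1, -1) := by
  rcases T_cases SP E hx with ⟨h, a, ha, rfl⟩ | ⟨h, a, ha, rfl⟩ | rfl
  · by_cases h0 : v.2 = 0
    · exact Or.inr (Or.inl (Prod.ext h h0))
    by_cases h1 : v.2 = 1
    · exact Or.inr (Or.inr (Or.inl (Prod.ext h h1)))
    rw [SP.vanish_p _ h0 h1, Submodule.mem_bot] at ha
    left; rw [ha, map_zero]
  · by_cases h0 : v.2 = 0
    · exact Or.inr (Or.inr (Or.inr (Or.inl (Prod.ext h h0))))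
    by_cases h1 : v.2 = -1
    · exact Or.inr (Or.inr (Or.inr (Or.inr (Prod.ext h h1))))
    rw [SP.vanish_m _ (by omega) (by omega), Submodule.mem_bot] at ha
    left; rw [ha, map_zero]
  · exact Or.inl rfl

theorem Tsub_le : Tsub fg ≤ ⨆ v, T SP E v := by
  have hp : ∀ j, (SP.Qp j).map E.ep ≤ ⨆ v, T SP E v := fun j => by
    rw [← T_pos SP E (v := (1, j)) rfl]; exact le_iSup (T SP E) _
  have hm : ∀ j, (SP.Qm j).map E.em ≤ ⨆ v, T SP E v := fun j => by
    have := T_neg SP E (v := (-1, -j)) rfl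
    rw [neg_neg] at this
    rw [← this]; exact le_iSup (T SP E) _
  unfold Tsub
  rw [← E.range_m, ← E.range_p, LinearMap.range_eq_map, LinearMap.range_eq_map, ← SP.sup_m,
    ← SP.sup_p, Submodule.map_sup, Submodule.map_sup]
  exact sup_le (sup_le (hm 0) (hm 1)) (sup_le (hp 0) (hp 1))

/-- the grading, by generators -/
def B (v : ℤ × ℤ) : Submodule K L :=
  if v.1 = 1 ∨ v.1 = -1 then T SP E v else
    ⨆ (w : ℤ × ℤ) (u : ℤ × ℤ) (_ : w + u = v), brkSpan K (T SP E w) (T SP E u)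

theorem B_odd {v : ℤ × ℤ} (h : v.1 = 1 ∨ v.1 = -1) : B SP E v = T SP E v := by simp [B, h]
theorem B_even {v : ℤ × ℤ} (h : ¬ (v.1 = 1 ∨ v.1 = -1)) : B SP E v =
    ⨆ (w : ℤ × ℤ) (u : ℤ × ℤ) (_ : w + u = v), brkSpan K (T SP E w) (T SP E u) := by
  rw [B, if_neg h]

theorem T_le_B (v : ℤ × ℤ) : T SP E v ≤ B SP E v := by
  by_cases h : v.1 = 1 ∨ v.1 = -1
  · rw [B_odd SP E h]
  · rw [T_bot SP E (fun e => h (Or.inl e)) (fun e => h (Or.inr e))]; exact bot_le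

theorem lie_mem_B {w u : ℤ × ℤ} {x y : L} (hx : x ∈ T SP E w) (hy : y ∈ T SP E u) :
    ⁅x, y⁆ ∈ B SP E (w + u) := by
  rcases T_cases SP E hx with ⟨h, -⟩ | ⟨h, -⟩ | rfl
  · rcases T_cases SP E hy with ⟨h', -⟩ | ⟨h', -⟩ | rfl
    · rw [B_even SP E (by simp only [Prod.fst_add]; omega)]
      exact Submodule.mem_iSup_of_mem w (Submodule.mem_iSup_of_mem u
        (Submodule.mem_iSup_of_mem rfl (mem_brkSpan hx hy)))
    · rw [B_even SP E (by simp only [Prod.fst_add]; omega)]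
      exact Submodule.mem_iSup_of_mem w (Submodule.mem_iSup_of_mem u
        (Submodule.mem_iSup_of_mem rfl (mem_brkSpan hx hy)))
    · simp
  · rcases T_cases SP E hy with ⟨h', -⟩ | ⟨h', -⟩ | rfl
    · rw [B_even SP E (by simp only [Prod.fst_add]; omega)]
      exact Submodule.mem_iSup_of_mem w (Submodule.mem_iSup_of_mem u
        (Submodule.mem_iSup_of_mem rfl (mem_brkSpan hx hy)))
    · rw [B_even SP E (by simp only [Prod.fst_add]; omega)]
      exact Submodule.mem_iSup_of_mem w (Submodule.mem_iSup_of_mem u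
        (Submodule.mem_iSup_of_mem rfl (mem_brkSpan hx hy)))
    · simp
  · simp

/-- `B` is the least family containing `T` and its brackets -/
theorem B_le {v : ℤ × ℤ} {X : Submodule K L} (h1 : v.1 = 1 ∨ v.1 = -1 → T SP E v ≤ X)
    (h2 : ¬ (v.1 = 1 ∨ v.1 = -1) → ∀ w u x y, w + u = v → x ∈ T SP E w → y ∈ T SP E u → ⁅x, y⁆ ∈ X) :
    B SP E v ≤ X := by
  by_cases h : v.1 = 1 ∨ v.1 = -1
  · rw [B_odd SP E h]; exact h1 h
  · rw [B_even SP E h]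
    exact iSup_le fun w => iSup_le fun u => iSup_le fun e =>
      brkSpan_le fun x hx y hy => h2 h w u x y e hx hy

theorem B_le_of {h : ℤ × ℤ → Submodule K L} (hT : ∀ v, v.1 = 1 ∨ v.1 = -1 → h v = T SP E v)
    (hl : ∀ (v w : ℤ × ℤ) (x y : L), x ∈ h v → y ∈ h w → ⁅x, y⁆ ∈ h (v + w)) (v : ℤ × ℤ) :
    B SP E v ≤ h v := by
  have hT' : ∀ v, T SP E v ≤ h v := by
    intro v
    by_cases hv : v.1 = 1 ∨ v.1 = -1
    · rw [hT v hv]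
    · rw [T_bot SP E (fun e => hv (Or.inl e)) (fun e => hv (Or.inr e))]; exact bot_le
  refine B_le SP E (fun _ => hT' v) ?_
  rintro - w u x y rfl hx hy
  exact hl _ _ _ _ (hT' w hx) (hT' u hy)

theorem B_le_H (v : ℤ × ℤ) : B SP E v ≤ H SP E v :=
  B_le_of SP E (fun v hv => H_odd SP E hv) (H_lie SP E) v

theorem T_lie_M {v : ℤ × ℤ} {x y : L} (hx : x ∈ T SP E v) (hy : y ∈ ⨆ w, B SP E w) :
    ⁅x, y⁆ ∈ ⨆ w, B SP E w := by
  have : (⨆ w, B SP E w) ≤ (⨆ w, B SP E w).comap (LieAlgebra.ad K L x : L →ₗ[K] L) := by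
    refine iSup_le fun w => ?_
    intro z hz
    rw [Submodule.mem_comap, LieAlgebra.ad_apply]
    by_cases hw : w.1 = 1 ∨ w.1 = -1
    · rw [B_odd SP E hw] at hz
      exact Submodule.mem_iSup_of_mem _ (lie_mem_B SP E hx hz)
    · have hz' := B_le_H SP E w hz
      rw [H_even SP E hw] at hz'
      rw [← lie_skew]
      exact neg_mem (Submodule.mem_iSup_of_mem _ (T_le_B SP E _ (hz'.2 _ _ hx)))
  exact this hy

theorem M_lie_M {x y : L} (hx : x ∈ ⨆ w, B SP E w) (hy : y ∈ ⨆ w, B SP E w) :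
    ⁅x, y⁆ ∈ ⨆ w, B SP E w := by
  rw [← lie_skew]
  refine neg_mem ?_
  have : (⨆ w, B SP E w) ≤ (⨆ w, B SP E w).comap (LieAlgebra.ad K L y : L →ₗ[K] L) := by
    refine iSup_le fun w => B_le SP E (fun _ z hz => ?_) (fun _ a b z t _ hz ht => ?_)
    · rw [Submodule.mem_comap, LieAlgebra.ad_apply, ← lie_skew]
      exact neg_mem (T_lie_M SP E hz hy)
    · rw [Submodule.mem_comap, LieAlgebra.ad_apply, ← lie_skew, lie_lie]
      exact neg_mem (sub_mem (T_lie_M SP E hz (T_lie_M SP E ht hy))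
        (T_lie_M SP E ht (T_lie_M SP E hz hy)))
  exact this hx

theorem iSup_B (ht : Tight K fg) : (⨆ w, B SP E w) = ⊤ := by
  let S : LieSubalgebra K L :=
    { (⨆ w, B SP E w : Submodule K L) with
      lie_mem' := fun {x y} hx hy => M_lie_M SP E hx hy }
  have hS : LieSubalgebra.lieSpan K L (Tsub fg : Set L) ≤ S := by
    rw [LieSubalgebra.lieSpan_le]
    intro x hx
    have := (Tsub_le SP E).trans (iSup_mono (T_le_B SP E)) hx
    exact this
  rw [ht.1] at hS
  rw [eq_top_iff]
  intro x _
  exact hS (LieSubalgebra.mem_top x)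

theorem B_le_g (v : ℤ × ℤ) : B SP E v ≤ fg.g v.1 := (B_le_H SP E v).trans (H_le_g SP E v)

theorem g_eq (ht : Tight K fg) (i : ℤ) : fg.g i = ⨆ j, B SP E (i, j) := by
  have h1 : (⨆ i, ⨆ j, B SP E (i, j)) = ⊤ := by
    rw [← iSup_B SP E ht, iSup_prod]
  have := (iSupIndep.le_iff_eq_of_iSup_eq_top fg.internal.submodule_iSupIndep h1).1
    (fun i => iSup_le fun j => B_le_g SP E (i, j))
  exact (congrFun this i).symm

theorem central_zero (ht : Tight K fg) {i : ℤ} (hi : ¬ (i = 1 ∨ i = -1)) {x : L}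
    (hx : x ∈ fg.g i) (h0 : ∀ w y, y ∈ T SP E w → ⁅x, y⁆ = 0) : x = 0 := by
  refine ht.2 x ?_ ?_
  · rw [g_eq SP E ht i] at hx
    have : (⨆ j, B SP E (i, j)) ≤ brkSpan K (Tsub fg) (Tsub fg) := by
      refine iSup_le fun j => B_le SP E (fun h => absurd h hi) (fun _ w u a b _ ha hb => ?_)
      exact mem_brkSpan (T_le_Tsub SP E _ ha) (T_le_Tsub SP E _ hb)
    exact this hx
  · have hker : (⨆ w, B SP E w) ≤ LinearMap.ker (LieAlgebra.ad K L x : L →ₗ[K] L) := by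
      refine iSup_le fun w => B_le SP E (fun _ z hz => ?_) (fun _ a b z t _ hz ht => ?_)
      · rw [LinearMap.mem_ker, LieAlgebra.ad_apply]
        exact h0 w z hz
      · rw [LinearMap.mem_ker, LieAlgebra.ad_apply, leibniz_lie, h0 _ _ hz, h0 _ _ ht]
        simp
    rw [iSup_B SP E ht] at hker
    intro u
    exact hker (Submodule.mem_top (x := u))

theorem T_row (i : ℤ) : iSupIndep fun j => T SP E (i, j) := by
  by_cases h : i = 1
  · subst h
    refine indep_two 0 1 ?_ ?_
    · rw [T_pos SP E rfl, T_pos SP E rfl]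
      exact Submodule.disjoint_map E.inj_p SP.disj_p
    · intro j h0 h1
      rw [T_pos SP E rfl]
      simp [SP.vanish_p j h0 h1]
  by_cases h' : i = -1
  · subst h'
    refine indep_two 0 (-1) ?_ ?_
    · rw [T_neg SP E rfl, T_neg SP E rfl]
      simpa using Submodule.disjoint_map E.inj_m SP.disj_m
    · intro j h0 h1
      rw [T_neg SP E rfl]
      simp [SP.vanish_m (-j) (by omega) (by omega)]
  · refine indep_two 0 1 ?_ ?_
    · rw [T_bot SP E h h']; exact disjoint_bot_left
    · intro j _ _
      exact T_bot SP E h h'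

theorem H_indep (ht : Tight K fg) : iSupIndep (H SP E) := by
  refine indep_of_rows fg.internal.submodule_iSupIndep (H_le_g SP E) fun i => ?_
  by_cases hi : i = 1 ∨ i = -1
  · have : (fun j => H SP E (i, j)) = fun j => T SP E (i, j) := funext fun j => H_odd SP E hi
    rw [this]
    exact T_row SP E i
  · rw [iSupIndep_iff_finsetSum_eq_zero_imp_eq_zero]
    intro s x hx h0 j hj
    have hx' : ∀ j ∈ s, x j ∈ N SP E (i, j) := fun j hj => by
      rw [← H_even SP E (v := (i, j)) hi]; exact hx j hj
    refine central_zero SP E ht hi (hx' j hj).1 ?_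
    intro w y hy
    have hr : iSupIndep fun j => T SP E ((i, j) + w) :=
      (T_row SP E (i + w.1)).comp (f := fun j => j + w.2) (add_left_injective w.2)
    rw [iSupIndep_iff_finsetSum_eq_zero_imp_eq_zero] at hr
    refine hr s (fun j => ⁅x j, y⁆) (fun j hj => (hx' j hj).2 w y hy) ?_ j hj
    rw [← sum_lie, h0, zero_lie]

theorem H_supp (ht : Tight K fg) (v : ℤ × ℤ) (hv : v ∉ BC2Support) : H SP E v = ⊥ := by
  rw [eq_bot_iff]
  intro x hx
  rw [Submodule.mem_bot]
  by_cases ho : v.1 = 1 ∨ v.1 = -1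
  · rw [H_odd SP E ho] at hx
    rcases T_supp SP E hx with h | rfl | rfl | rfl | rfl
    · exact h
    all_goals exact absurd (by simp [BC2Support]) hv
  · rw [H_even SP E ho] at hx
    refine central_zero SP E ht ho hx.1 fun w y hy => ?_
    rcases T_supp SP E (hx.2 w y hy) with h | h
    · exact h
    rcases T_supp SP E hy with h' | h'
    · rw [h', lie_zero]
    exfalso
    apply hv
    have hd : ∀ p q : ℤ × ℤ, (p = (1, 0) ∨ p = (1, 1) ∨ p = (-1, 0) ∨ p = (-1, -1)) →
        (q = (1, 0) ∨ q = (1, 1) ∨ q = (-1, 0) ∨ q = (-1, -1)) → p - q ∈ BC2Support := by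
      rintro p q (rfl | rfl | rfl | rfl) (rfl | rfl | rfl | rfl) <;>
        simp [BC2Support, Prod.ext_iff]
    have := hd _ _ h h'
    rwa [add_sub_cancel_right] at this

theorem H_std (ht : Tight K fg) : IsStdBC2Grading SP E (H SP E) := by
  refine ⟨?_, H_indep SP E ht, H_lie SP E, H_supp SP E ht, ?_, ?_⟩
  · rw [eq_top_iff, ← iSup_B SP E ht]
    exact iSup_mono (B_le_H SP E)
  · intro i
    rw [H_odd SP E (Or.inl rfl), T_pos SP E rfl]
  · intro i
    rw [H_odd SP E (Or.inr rfl), T_neg SP E rfl, neg_neg]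

theorem std_eq (ht : Tight K fg) {h : ℤ × ℤ → Submodule K L} (hh : IsStdBC2Grading SP E h) :
    h = B SP E := by
  obtain ⟨-, hi, hl, -, hp, hm⟩ := hh
  refine ((iSupIndep.le_iff_eq_of_iSup_eq_top hi (iSup_B SP E ht)).1
    (B_le_of SP E ?_ hl)).symm
  rintro ⟨i, j⟩ (rfl | rfl)
  · rw [hp, T_pos SP E rfl]
  · have := hm (-j)
    rw [neg_neg] at this
    rw [this, T_neg SP E rfl]

/-- computing the even components -/
theorem B_eq {v : ℤ × ℤ} (hv : ¬ (v.1 = 1 ∨ v.1 = -1)) {X : Submodule K L}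
    (h1 : X ≤ B SP E v)
    (h2 : ∀ w u x y, w + u = v → x ∈ T SP E w → y ∈ T SP E u →
      (w = (1, 0) ∨ w = (1, 1) ∨ w = (-1, 0) ∨ w = (-1, -1)) →
      (u = (1, 0) ∨ u = (1, 1) ∨ u = (-1, 0) ∨ u = (-1, -1)) → ⁅x, y⁆ ∈ X) :
    B SP E v = X := by
  refine le_antisymm (B_le SP E (fun h => absurd h hv) fun _ w u x y e hx hy => ?_) h1
  rcases T_supp SP E hx with rfl | hw
  · simp
  rcases T_supp SP E hy with rfl | hu
  · simp
  exact h2 w u x y e hx hy hw hu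

theorem brk_le_B {v : ℤ × ℤ} (w u : ℤ × ℤ) (e : w + u = v) :
    brkSpan K (T SP E w) (T SP E u) ≤ B SP E v := by
  subst e
  exact brkSpan_le fun x hx y hy => lie_mem_B SP E hx hy

/-- components attained by a single unordered pair of odd degrees -/
theorem B_single {v w u : ℤ × ℤ} (hv : ¬ (v.1 = 1 ∨ v.1 = -1)) (e : w + u = v)
    (huniq : ∀ a b : ℤ × ℤ, a + b = v →
      (a = (1, 0) ∨ a = (1, 1) ∨ a = (-1, 0) ∨ a = (-1, -1)) →
      (b = (1, 0) ∨ b = (1, 1) ∨ b = (-1, 0) ∨ b = (-1, -1)) →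
      (a = w ∧ b = u) ∨ (a = u ∧ b = w)) :
    B SP E v = brkSpan K (T SP E w) (T SP E u) := by
  refine B_eq SP E hv (brk_le_B SP E w u e) fun a b x y hab hx hy ha hb => ?_
  rcases huniq a b hab ha hb with ⟨rfl, rfl⟩ | ⟨rfl, rfl⟩
  · exact mem_brkSpan hx hy
  · rw [← lie_skew]
    exact neg_mem (mem_brkSpan hy hx)

end

end BC2Aux

/-- Let `P` be an SP-graded Kantor pair.  Then there is a unique
BC₂-grading of `𝔎(P)` (represented by an arbitrary 5-graded Lie algebra `L` tightly
enveloping `P`) with `𝔎(P)_{σ1,σi} = P_i^σ`; it satisfies the formulas (18), and its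
first component grading is the standard 5-grading. -/
theorem statement10 {K : Type*} [CommRing K] (h6 : IsUnit (6 : K))
    {Pm Pp : Type*} [AddCommGroup Pm] [AddCommGroup Pp] [Module K Pm] [Module K Pp]
    (KP : KantorPair K Pm Pp) (SP : SPGrading KP)
    {L : Type*} [LieRing L] [LieAlgebra K L] (fg : FiveGrading K L)
    (E : Envelops KP fg) (ht : Tight K fg) :
    (∃! h : ℤ × ℤ → Submodule K L, IsStdBC2Grading SP E h) ∧
    (∀ h : ℤ × ℤ → Submodule K L, IsStdBC2Grading SP E h →
      -- the formulas (18)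
      (h (2, 0) = brkSpan K ((SP.Qp 0).map E.ep) ((SP.Qp 0).map E.ep) ∧
       h (2, 2) = brkSpan K ((SP.Qp 1).map E.ep) ((SP.Qp 1).map E.ep) ∧
       h (2, 1) = brkSpan K ((SP.Qp 0).map E.ep) ((SP.Qp 1).map E.ep) ∧
       h (-2, 0) = brkSpan K ((SP.Qm 0).map E.em) ((SP.Qm 0).map E.em) ∧
       h (-2, -2) = brkSpan K ((SP.Qm 1).map E.em) ((SP.Qm 1).map E.em) ∧
       h (-2, -1) = brkSpan K ((SP.Qm 0).map E.em) ((SP.Qm 1).map E.em) ∧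
       h (0, 1) = brkSpan K ((SP.Qp 1).map E.ep) ((SP.Qm 0).map E.em) ∧
       h (0, -1) = brkSpan K ((SP.Qm 1).map E.em) ((SP.Qp 0).map E.ep) ∧
       h (0, 0) = brkSpan K ((SP.Qp 0).map E.ep) ((SP.Qm 0).map E.em)
          ⊔ brkSpan K ((SP.Qp 1).map E.ep) ((SP.Qm 1).map E.em)) ∧
      -- the first component grading is the standard 5-grading
      (∀ i : ℤ, fg.g i = ⨆ j : ℤ, h (i, j))) := by
  classical
  have tp : ∀ j, (SP.Qp j).map E.ep = BC2Aux.T SP E (1, j) := fun j =>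
    (BC2Aux.T_pos SP E (v := (1, j)) rfl).symm
  have tm0 : (SP.Qm 0).map E.em = BC2Aux.T SP E (-1, 0) := by
    rw [BC2Aux.T_neg SP E rfl]; simp
  have tm1 : (SP.Qm 1).map E.em = BC2Aux.T SP E (-1, -1) := by
    rw [BC2Aux.T_neg SP E rfl]; simp
  refine ⟨⟨BC2Aux.H SP E, BC2Aux.H_std SP E ht, fun h hh => ?_⟩, fun h hh => ?_⟩
  · rw [BC2Aux.std_eq SP E ht hh, BC2Aux.std_eq SP E ht (BC2Aux.H_std SP E ht)]
  · rw [BC2Aux.std_eq SP E ht hh, tp, tp, tm0, tm1]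
    refine ⟨⟨?_, ?_, ?_, ?_, ?_, ?_, ?_, ?_, ?_⟩, BC2Aux.g_eq SP E ht⟩
    case refine_9 =>
      refine BC2Aux.B_eq SP E (by simp) (sup_le (BC2Aux.brk_le_B SP E _ _ (by simp))
        (BC2Aux.brk_le_B SP E _ _ (by simp))) fun w u x y e hx hy hw hu => ?_
      rcases hw with rfl | rfl | rfl | rfl <;> rcases hu with rfl | rfl | rfl | rfl <;>
        simp only [Prod.mk_add_mk, Prod.mk.injEq] at e
      all_goals first
        | omega
        | exact Submodule.mem_sup_left (BC2Aux.mem_brkSpan hx hy)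
        | exact Submodule.mem_sup_right (BC2Aux.mem_brkSpan hx hy)
        | (rw [← lie_skew]
           exact neg_mem (Submodule.mem_sup_left (BC2Aux.mem_brkSpan hy hx)))
        | (rw [← lie_skew]
           exact neg_mem (Submodule.mem_sup_right (BC2Aux.mem_brkSpan hy hx)))
    all_goals
      refine BC2Aux.B_single SP E (by simp) (by simp) ?_
      rintro ⟨a, a'⟩ ⟨b, b'⟩ e ha hb
      simp only [Prod.mk_add_mk, Prod.mk.injEq] at e ha hb ⊢
      omega
end

section
/- Let P be an SP-graded Kantor pair over 𝕂 and let P̌ be its reflection. Then the Kantor Lie algebras 𝔎(P̌) and 𝔎(P) are isomorphic as (ungraded) Lie algebras; consequently P is simple if and only if P̌ is simple, and P is central simple if and only if P̌ is central simple. -/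
namespace ReflAux

/-! ### Lie triple systems and their standard embeddings -/

section LTS

variable {K : Type*} [CommRing K]

/-- `ι : T → L` realizes the triple product `tri` and `L` is a standard embedding. -/
structure IsEnv {T L : Type*} [AddCommGroup T] [Module K T] [LieRing L] [LieAlgebra K L]
    (tri : T → T → T → T) (ι : T →ₗ[K] L) : Prop where
  inj : Function.Injective ι
  tri : ∀ a b c, ι (tri a b c) = ⁅⁅ι a, ι b⁆, ι c⁆
  disj : Disjoint (LinearMap.range ι) (brkSpan K (LinearMap.range ι) (LinearMap.range ι))
  gen : LieSubalgebra.lieSpan K L (LinearMap.range ι : Set L) = ⊤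
  ctr : ∀ z ∈ brkSpan K (LinearMap.range ι) (LinearMap.range ι), (∀ u : L, ⁅z, u⁆ = 0) → z = 0

variable {T M : Type*} [AddCommGroup T] [Module K T] [LieRing M] [LieAlgebra K M]

theorem brk_act {tri : T → T → T → T} (j : T →ₗ[K] M)
    (hj : ∀ a b c, j (tri a b c) = ⁅⁅j a, j b⁆, j c⁆) {d : M}
    (hd : d ∈ brkSpan K (LinearMap.range j) (LinearMap.range j)) (t : T) :
    ∃ s, ⁅d, j t⁆ = j s := by
  unfold brkSpan at hd
  induction hd using Submodule.span_induction with
  | mem x hx =>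
    obtain ⟨_, ⟨a, rfl⟩, _, ⟨b, rfl⟩, rfl⟩ := hx
    exact ⟨tri a b t, (hj a b t).symm⟩
  | zero => exact ⟨0, by simp⟩
  | add x y _ _ h1 h2 =>
    obtain ⟨s, hs⟩ := h1
    obtain ⟨s', hs'⟩ := h2
    exact ⟨s + s', by simp [hs, hs']⟩
  | smul a x _ h =>
    obtain ⟨s, hs⟩ := h
    exact ⟨a • s, by simp [hs]⟩

theorem brk_mem (j : T →ₗ[K] M) (a b : T) :
    ⁅j a, j b⁆ ∈ brkSpan K (LinearMap.range j) (LinearMap.range j) :=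
  Submodule.subset_span ⟨_, ⟨a, rfl⟩, _, ⟨b, rfl⟩, rfl⟩

theorem brk_brk {tri : T → T → T → T} (j : T →ₗ[K] M)
    (hj : ∀ a b c, j (tri a b c) = ⁅⁅j a, j b⁆, j c⁆) {d e : M}
    (hd : d ∈ brkSpan K (LinearMap.range j) (LinearMap.range j))
    (he : e ∈ brkSpan K (LinearMap.range j) (LinearMap.range j)) :
    ⁅d, e⁆ ∈ brkSpan K (LinearMap.range j) (LinearMap.range j) := by
  have he' := he
  unfold brkSpan at he
  induction he using Submodule.span_induction with
  | mem x hx =>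
    obtain ⟨_, ⟨a, rfl⟩, _, ⟨b, rfl⟩, rfl⟩ := hx
    obtain ⟨s, hs⟩ := brk_act j hj hd a
    obtain ⟨s', hs'⟩ := brk_act j hj hd b
    rw [leibniz_lie, hs, hs']
    exact add_mem (brk_mem j _ _) (brk_mem j _ _)
  | zero => simp
  | add x y hx hy h1 h2 => rw [lie_add]; exact add_mem (h1 hx) (h2 hy)
  | smul a x hx h => rw [lie_smul]; exact Submodule.smul_mem _ _ (h hx)

theorem span_decomp {tri : T → T → T → T} (j : T →ₗ[K] M)
    (hj : ∀ a b c, j (tri a b c) = ⁅⁅j a, j b⁆, j c⁆) {x : M}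
    (hx : x ∈ LieSubalgebra.lieSpan K M (LinearMap.range j : Set M)) :
    ∃ t, ∃ d ∈ brkSpan K (LinearMap.range j) (LinearMap.range j), x = j t + d := by
  induction hx using LieSubalgebra.lieSpan_induction with
  | mem x h =>
    obtain ⟨t, rfl⟩ := h
    exact ⟨t, 0, zero_mem _, by simp⟩
  | zero => exact ⟨0, 0, zero_mem _, by simp⟩
  | add x y _ _ h1 h2 =>
    obtain ⟨t, d, hd, rfl⟩ := h1
    obtain ⟨t', d', hd', rfl⟩ := h2
    exact ⟨t + t', d + d', add_mem hd hd', by rw [map_add]; abel⟩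
  | smul a x _ h =>
    obtain ⟨t, d, hd, rfl⟩ := h
    exact ⟨a • t, a • d, Submodule.smul_mem _ _ hd, by simp⟩
  | lie x y _ _ h1 h2 =>
    obtain ⟨t, d, hd, rfl⟩ := h1
    obtain ⟨t', d', hd', rfl⟩ := h2
    obtain ⟨s, hs⟩ := brk_act j hj hd t'
    obtain ⟨s', hs'⟩ := brk_act j hj hd' t
    refine ⟨s - s', ⁅j t, j t'⁆ + ⁅d, d'⁆, add_mem (brk_mem j _ _) (brk_brk j hj hd hd'), ?_⟩
    rw [map_sub, ← hs, ← hs', lie_add, add_lie, add_lie, ← lie_skew (j t) d']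
    abel

theorem brk_map {L : Type*} [LieRing L] [LieAlgebra K L] (j : T →ₗ[K] M) (p : M →ₗ⁅K⁆ L)
    (ι : T →ₗ[K] L) (hι : ∀ t, p (j t) = ι t) {d : M}
    (hd : d ∈ brkSpan K (LinearMap.range j) (LinearMap.range j)) :
    p d ∈ brkSpan K (LinearMap.range ι) (LinearMap.range ι) := by
  unfold brkSpan at hd
  induction hd using Submodule.span_induction with
  | mem x hx =>
    obtain ⟨_, ⟨a, rfl⟩, _, ⟨b, rfl⟩, rfl⟩ := hx
    rw [LieHom.map_lie, hι, hι]
    exact brk_mem ι _ _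
  | zero => simp
  | add x y _ _ h1 h2 => rw [map_add]; exact add_mem h1 h2
  | smul a x _ h => rw [map_smul]; exact Submodule.smul_mem _ _ h

theorem central_of_kills {L : Type*} [LieRing L] [LieAlgebra K L] (ι : T →ₗ[K] L)
    (gen : LieSubalgebra.lieSpan K L (LinearMap.range ι : Set L) = ⊤) (z : L)
    (hz : ∀ t, ⁅z, ι t⁆ = 0) (u : L) : ⁅z, u⁆ = 0 := by
  have hu : u ∈ LieSubalgebra.lieSpan K L (LinearMap.range ι : Set L) := by rw [gen]; trivial
  induction hu using LieSubalgebra.lieSpan_induction with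
  | mem x h => obtain ⟨t, rfl⟩ := h; exact hz t
  | zero => simp
  | add x y _ _ h1 h2 => rw [lie_add, h1, h2, add_zero]
  | smul a x _ h => rw [lie_smul, h, smul_zero]
  | lie x y _ _ h1 h2 => rw [leibniz_lie, h1, h2]; simp

theorem ker_zero {L₁ L₂ : Type*} [LieRing L₁] [LieAlgebra K L₁] [LieRing L₂] [LieAlgebra K L₂]
    {tri : T → T → T → T} (j : T →ₗ[K] M)
    (hj : ∀ a b c, j (tri a b c) = ⁅⁅j a, j b⁆, j c⁆)
    (p : M →ₗ⁅K⁆ L₁) (q : M →ₗ⁅K⁆ L₂) (ι₁ : T →ₗ[K] L₁) (ι₂ : T →ₗ[K] L₂)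
    (h₁ : IsEnv tri ι₁) (h₂ : IsEnv tri ι₂)
    (hp : ∀ t, p (j t) = ι₁ t) (hq : ∀ t, q (j t) = ι₂ t)
    (hpq : ∀ x, p x = 0 → q x = 0 → x = 0) {x : M}
    (hx : x ∈ LieSubalgebra.lieSpan K M (LinearMap.range j : Set M)) (hx0 : p x = 0) :
    x = 0 := by
  obtain ⟨t, d, hd, rfl⟩ := span_decomp j hj hx
  rw [map_add, hp] at hx0
  have hpd := brk_map j p ι₁ hp hd
  have hqd := brk_map j q ι₂ hq hd
  have ht0 : ι₁ t = 0 := by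
    refine (Submodule.disjoint_def.1 h₁.disj) _ ⟨t, rfl⟩ ?_
    rw [eq_neg_of_add_eq_zero_left hx0]
    exact neg_mem hpd
  have hd0 : p d = 0 := by rwa [ht0, zero_add] at hx0
  have ht : t = 0 := h₁.inj (by rw [ht0, map_zero])
  have hq0 : q d = 0 := by
    refine h₂.ctr _ hqd (central_of_kills ι₂ h₂.gen _ fun s => ?_)
    obtain ⟨u, hu⟩ := brk_act j hj hd s
    have hu1 : ι₁ u = 0 := by rw [← hp, ← hu, LieHom.map_lie, hd0, zero_lie]
    have hu0 : u = 0 := h₁.inj (by rw [hu1, map_zero])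
    rw [← hq, ← LieHom.map_lie, hu, hu0, map_zero, map_zero]
  rw [ht, map_zero, zero_add]
  exact hpq d hd0 hq0

theorem bij_of_env {L₁ L₂ : Type*} [LieRing L₁] [LieAlgebra K L₁] [LieRing L₂] [LieAlgebra K L₂]
    {tri : T → T → T → T} (j : T →ₗ[K] M)
    (hj : ∀ a b c, j (tri a b c) = ⁅⁅j a, j b⁆, j c⁆)
    (p : M →ₗ⁅K⁆ L₁) (q : M →ₗ⁅K⁆ L₂) (ι₁ : T →ₗ[K] L₁) (ι₂ : T →ₗ[K] L₂)
    (h₁ : IsEnv tri ι₁) (h₂ : IsEnv tri ι₂)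
    (hp : ∀ t, p (j t) = ι₁ t) (hq : ∀ t, q (j t) = ι₂ t)
    (hpq : ∀ x, p x = 0 → q x = 0 → x = 0) :
    Function.Bijective
      (p.comp (LieSubalgebra.lieSpan K M (LinearMap.range j : Set M)).incl) := by
  constructor
  · rw [injective_iff_map_eq_zero]
    rintro ⟨x, hx⟩ hx0
    exact Subtype.ext (ker_zero j hj p q ι₁ ι₂ h₁ h₂ hp hq hpq hx hx0)
  · intro y
    have hy : y ∈ LieSubalgebra.lieSpan K L₁ (LinearMap.range ι₁ : Set L₁) := by
      rw [h₁.gen]; trivial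
    have hle : LieSubalgebra.lieSpan K L₁ (LinearMap.range ι₁ : Set L₁) ≤
        (p.comp (LieSubalgebra.lieSpan K M (LinearMap.range j : Set M)).incl).range := by
      rw [LieSubalgebra.lieSpan_le]
      rintro _ ⟨t, rfl⟩
      exact ⟨⟨j t, LieSubalgebra.subset_lieSpan ⟨t, rfl⟩⟩, hp t⟩
    exact hle hy

/-- First projection as a Lie homomorphism. -/
def pfst (K : Type*) [CommRing K] (L₁ L₂ : Type*) [LieRing L₁] [LieAlgebra K L₁] [LieRing L₂]
    [LieAlgebra K L₂] : (L₁ × L₂) →ₗ⁅K⁆ L₁ :=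
  { LinearMap.fst K L₁ L₂ with map_lie' := rfl }

/-- Second projection as a Lie homomorphism. -/
def psnd (K : Type*) [CommRing K] (L₁ L₂ : Type*) [LieRing L₁] [LieAlgebra K L₁] [LieRing L₂]
    [LieAlgebra K L₂] : (L₁ × L₂) →ₗ⁅K⁆ L₂ :=
  { LinearMap.snd K L₁ L₂ with map_lie' := rfl }

theorem env_iso {L₁ L₂ : Type*} [LieRing L₁] [LieAlgebra K L₁] [LieRing L₂] [LieAlgebra K L₂]
    {tri : T → T → T → T} (ι₁ : T →ₗ[K] L₁) (ι₂ : T →ₗ[K] L₂)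
    (h₁ : IsEnv tri ι₁) (h₂ : IsEnv tri ι₂) : Nonempty (L₁ ≃ₗ⁅K⁆ L₂) := by
  have hj : ∀ a b c, (ι₁.prod ι₂) (tri a b c)
      = ⁅⁅(ι₁.prod ι₂) a, (ι₁.prod ι₂) b⁆, (ι₁.prod ι₂) c⁆ := fun a b c =>
    Prod.ext (h₁.tri a b c) (h₂.tri a b c)
  have b1 := bij_of_env (ι₁.prod ι₂) hj (pfst K L₁ L₂) (psnd K L₁ L₂) ι₁ ι₂ h₁ h₂
    (fun _ => rfl) (fun _ => rfl) (fun x hx hy => Prod.ext hx hy)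
  have b2 := bij_of_env (ι₁.prod ι₂) hj (psnd K L₁ L₂) (pfst K L₁ L₂) ι₂ ι₁ h₂ h₁
    (fun _ => rfl) (fun _ => rfl) (fun x hx hy => Prod.ext hy hx)
  exact ⟨(LieEquiv.ofBijective _ b1).symm.trans (LieEquiv.ofBijective _ b2)⟩

theorem IsEnv.comp {T' L : Type*} [AddCommGroup T'] [Module K T'] [LieRing L] [LieAlgebra K L]
    {tri : T → T → T → T} {tri' : T' → T' → T' → T'} {ι : T →ₗ[K] L} (h : IsEnv tri ι)
    (φ : T' ≃ₗ[K] T) (hφ : ∀ a b c, φ (tri' a b c) = tri (φ a) (φ b) (φ c)) :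
    IsEnv tri' (ι.comp φ.toLinearMap) := by
  have hr : LinearMap.range (ι.comp φ.toLinearMap) = LinearMap.range ι := by
    rw [LinearMap.range_comp, LinearEquiv.range, Submodule.map_top]
  refine ⟨?_, ?_, ?_, ?_, ?_⟩
  · exact h.inj.comp φ.injective
  · intro a b c
    simp [hφ, h.tri]
  · rw [hr]; exact h.disj
  · rw [hr]; exact h.gen
  · rw [hr]; exact h.ctr

/-- Ideals of a triple system. -/
def TIdeal (tri : T → T → T → T) (I : Submodule K T) : Prop :=
  ∀ x ∈ I, ∀ a b, tri x a b ∈ I ∧ tri a x b ∈ I ∧ tri a b x ∈ I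

/-- Simplicity of a triple system. -/
def TSimple (K : Type*) [CommRing K] {T : Type*} [AddCommGroup T] [Module K T]
    (tri : T → T → T → T) : Prop :=
  (∃ a b c, tri a b c ≠ 0) ∧ ∀ I : Submodule K T, TIdeal tri I → I = ⊥ ∨ I = ⊤

/-- Centroid of a triple system. -/
def TCentroid (tri : T → T → T → T) (ω : T →ₗ[K] T) : Prop :=
  ∀ a b c, ω (tri a b c) = tri (ω a) b c ∧ ω (tri a b c) = tri a (ω b) c ∧
    ω (tri a b c) = tri a b (ω c)

/-- Centrality of a triple system. -/
def TCentral (K : Type*) [CommRing K] {T : Type*} [AddCommGroup T] [Module K T]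
    (tri : T → T → T → T) : Prop :=
  (∀ ω : T →ₗ[K] T, TCentroid tri ω → ∃ a : K, ω = a • LinearMap.id) ∧
  ∀ a : K, a • (LinearMap.id : T →ₗ[K] T) = 0 → a = 0

theorem TSimple.transfer {T' : Type*} [AddCommGroup T'] [Module K T']
    {tri : T → T → T → T} {tri' : T' → T' → T' → T'} (φ : T' ≃ₗ[K] T)
    (hφ : ∀ a b c, φ (tri' a b c) = tri (φ a) (φ b) (φ c)) (h : TSimple K tri) :
    TSimple K tri' := by
  have hs : ∀ a b c, φ.symm (tri a b c) = tri' (φ.symm a) (φ.symm b) (φ.symm c) := by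
    intro a b c
    apply φ.injective
    simp [hφ]
  obtain ⟨⟨a, b, c, habc⟩, h2⟩ := h
  refine ⟨⟨φ.symm a, φ.symm b, φ.symm c, ?_⟩, ?_⟩
  · rw [← hs]; simpa using habc
  · intro I hI
    have : TIdeal tri (I.comap φ.symm.toLinearMap) := by
      intro x hx a b
      have := hI _ hx (φ.symm a) (φ.symm b)
      simpa [hs] using this
    rcases h2 _ this with h0 | h0
    · left
      rw [eq_bot_iff]
      intro x hx
      have hx' : φ x ∈ I.comap φ.symm.toLinearMap := by simpa using hx
      rw [h0] at hx'
      simpa using hx'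
    · right
      rw [eq_top_iff]
      intro x _
      have hx' : φ x ∈ I.comap φ.symm.toLinearMap := by rw [h0]; trivial
      simpa using hx'

theorem TCentral.transfer {T' : Type*} [AddCommGroup T'] [Module K T']
    {tri : T → T → T → T} {tri' : T' → T' → T' → T'} (φ : T' ≃ₗ[K] T)
    (hφ : ∀ a b c, φ (tri' a b c) = tri (φ a) (φ b) (φ c)) (h : TCentral K tri) :
    TCentral K tri' := by
  have hs : ∀ a b c, φ.symm (tri a b c) = tri' (φ.symm a) (φ.symm b) (φ.symm c) := by
    intro a b c
    apply φ.injective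
    simp [hφ]
  refine ⟨fun ω hω => ?_, fun a ha => ?_⟩
  · obtain ⟨a, ha⟩ := h.1 (φ.toLinearMap ∘ₗ ω ∘ₗ φ.symm.toLinearMap) (by
      intro x y z
      have := hω (φ.symm x) (φ.symm y) (φ.symm z)
      simp only [LinearMap.comp_apply, LinearEquiv.coe_coe, hs]
      refine ⟨?_, ?_, ?_⟩
      · rw [this.1, hφ]; simp
      · rw [this.2.1, hφ]; simp
      · rw [this.2.2, hφ]; simp)
    refine ⟨a, LinearMap.ext fun x => φ.injective ?_⟩
    have := LinearMap.congr_fun ha (φ x)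
    simpa using this
  · apply h.2
    ext x
    have := LinearMap.congr_fun ha (φ.symm x)
    apply φ.symm.injective
    simpa using this

end LTS

/-! ### The triple system of a Kantor pair -/

section Pair

variable {K : Type*} [CommRing K] {Pm Pp : Type*}
  [AddCommGroup Pm] [AddCommGroup Pp] [Module K Pm] [Module K Pp]

section zero
variable (KP : KantorPair K Pm Pp)
theorem tm_z1 (y z) : KP.tm 0 y z = 0 := by simpa using KP.tm_smul₁ 0 0 y z
theorem tm_z2 (x z) : KP.tm x 0 z = 0 := by simpa using KP.tm_smul₂ 0 x 0 z
theorem tm_z3 (x y) : KP.tm x y 0 = 0 := by simpa using KP.tm_smul₃ 0 x y 0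
theorem tp_z1 (y z) : KP.tp 0 y z = 0 := by simpa using KP.tp_smul₁ 0 0 y z
theorem tp_z2 (x z) : KP.tp x 0 z = 0 := by simpa using KP.tp_smul₂ 0 x 0 z
theorem tp_z3 (x y) : KP.tp x y 0 = 0 := by simpa using KP.tp_smul₃ 0 x y 0
end zero

/-- The Lie triple product on `P⁻ ⊕ P⁺`. -/
def tri (KP : KantorPair K Pm Pp) (a b c : Pm × Pp) : Pm × Pp :=
  (KP.tm a.1 b.2 c.1 - KP.tm b.1 a.2 c.1 + (KP.tm a.1 c.2 b.1 - KP.tm b.1 c.2 a.1),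
   KP.tp a.2 b.1 c.2 - KP.tp b.2 a.1 c.2 + (KP.tp a.2 c.1 b.2 - KP.tp b.2 c.1 a.2))

theorem tri_simple_of (KP : KantorPair K Pm Pp) (h : KP.IsSimplePair) : TSimple K (tri KP) := by
  obtain ⟨h1, h2⟩ := h
  refine ⟨?_, fun I hI => ?_⟩
  · rcases h1 with ⟨x, y, z, hh⟩ | ⟨x, y, z, hh⟩
    · refine ⟨(x, 0), (0, y), (z, 0), fun h0 => hh ?_⟩
      simpa [tri, tm_z1, tm_z2, tm_z3] using congrArg Prod.fst h0
    · refine ⟨(0, x), (y, 0), (0, z), fun h0 => hh ?_⟩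
      simpa [tri, tp_z1, tp_z2, tp_z3] using congrArg Prod.snd h0
  have e1 : ∀ x y z, tri KP (x, 0) (0, y) (z, 0) = (KP.tm x y z, 0) := by
    intros; simp [tri, tm_z1, tm_z2, tm_z3, tp_z1, tp_z2, tp_z3]
  have e2 : ∀ x y z, tri KP (0, x) (y, 0) (0, z) = (0, KP.tp x y z) := by
    intros; simp [tri, tm_z1, tm_z2, tm_z3, tp_z1, tp_z2, tp_z3]
  -- the homogeneous part of `I`
  have hA : KP.IsIdealPair (I.comap (LinearMap.inl K Pm Pp)) (I.comap (LinearMap.inr K Pm Pp)) := by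
    refine ⟨?_, ?_, ?_, ?_⟩
    · intro x z y q hq
      have hq' : (q, (0 : Pp)) ∈ I := hq
      have i1 := (hI _ hq' (x, 0) (0, y)).1
      have i2 := (hI _ hq' (x, 0) (0, y)).2.2
      have i3 := (hI _ hq' (0, y) (z, 0)).1
      rw [e1] at i2 i3
      exact ⟨i2, i3⟩
    · intro x z r hr
      have hr' : ((0 : Pm), r) ∈ I := hr
      have i1 := (hI _ hr' (x, 0) (z, 0)).2.1
      rw [e1] at i1
      exact i1
    · intro x z y q hq
      have hq' : ((0 : Pm), q) ∈ I := hq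
      have i2 := (hI _ hq' (0, x) (y, 0)).2.2
      have i3 := (hI _ hq' (y, 0) (0, z)).1
      rw [e2] at i2 i3
      exact ⟨i2, i3⟩
    · intro x z r hr
      have hr' : (r, (0 : Pp)) ∈ I := hr
      have i1 := (hI _ hr' (0, x) (0, z)).2.1
      rw [e2] at i1
      exact i1
  rcases h2 _ _ hA with ⟨am, ap⟩ | ⟨am, ap⟩
  swap
  · right
    rw [eq_top_iff]
    rintro ⟨x, y⟩ _
    have hx : x ∈ I.comap (LinearMap.inl K Pm Pp) := by rw [am]; trivial
    have hy : y ∈ I.comap (LinearMap.inr K Pm Pp) := by rw [ap]; trivial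
    have := add_mem (Submodule.mem_comap.1 hx) (Submodule.mem_comap.1 hy)
    simpa using this
  have zm : ∀ x : Pm, (x, (0 : Pp)) ∈ I → x = 0 := fun x hx => by
    have : x ∈ I.comap (LinearMap.inl K Pm Pp) := hx
    rw [am] at this; simpa using this
  have zp : ∀ x : Pp, ((0 : Pm), x) ∈ I → x = 0 := fun x hx => by
    have : x ∈ I.comap (LinearMap.inr K Pm Pp) := hx
    rw [ap] at this; simpa using this
  -- elements of `I` multiply to zero
  have km : ∀ u ∈ I, ∀ x z, KP.tm x u.2 z = 0 := by
    intro u hu x z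
    apply zm
    have := (hI u hu (x, 0) (z, 0)).2.1
    simpa [tri, tm_z1, tm_z2, tm_z3, tp_z1, tp_z2, tp_z3] using this
  have kp : ∀ u ∈ I, ∀ x z, KP.tp x u.1 z = 0 := by
    intro u hu x z
    apply zp
    have := (hI u hu (0, x) (0, z)).2.1
    simpa [tri, tm_z1, tm_z2, tm_z3, tp_z1, tp_z2, tp_z3] using this
  -- the projections of `I`
  have hB : KP.IsIdealPair (I.map (LinearMap.fst K Pm Pp)) (I.map (LinearMap.snd K Pm Pp)) := by
    refine ⟨?_, ?_, ?_, ?_⟩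
    · rintro x z y _ ⟨u, hu, rfl⟩
      have i2 := (hI _ hu (x, 0) (0, y)).2.2
      have i3 := (hI _ hu (0, y) (z, 0)).1
      refine ⟨⟨_, i2, ?_⟩, ⟨_, i3, ?_⟩⟩
      · simp [tri, tm_z1, tm_z2, tm_z3, tp_z1, tp_z2, tp_z3]
      · simp [tri, tm_z1, tm_z2, tm_z3, tp_z1, tp_z2, tp_z3]
    · rintro x z _ ⟨u, hu, rfl⟩
      have := km u hu x z
      simp [this]
    · rintro x z y _ ⟨u, hu, rfl⟩
      have i2 := (hI _ hu (0, x) (y, 0)).2.2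
      have i3 := (hI _ hu (y, 0) (0, z)).1
      refine ⟨⟨_, i2, ?_⟩, ⟨_, i3, ?_⟩⟩
      · simp [tri, tm_z1, tm_z2, tm_z3, tp_z1, tp_z2, tp_z3]
      · simp [tri, tm_z1, tm_z2, tm_z3, tp_z1, tp_z2, tp_z3]
    · rintro x z _ ⟨u, hu, rfl⟩
      have := kp u hu x z
      simp [this]
  rcases h2 _ _ hB with ⟨bm, bp⟩ | ⟨bm, bp⟩
  · left
    rw [eq_bot_iff]
    rintro ⟨x, y⟩ hxy
    have hx : x ∈ I.map (LinearMap.fst K Pm Pp) := ⟨_, hxy, rfl⟩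
    have hy : y ∈ I.map (LinearMap.snd K Pm Pp) := ⟨_, hxy, rfl⟩
    rw [bm] at hx
    rw [bp] at hy
    simp only [Submodule.mem_bot] at hx hy
    simp [hx, hy]
  · exfalso
    rcases h1 with ⟨x, y, z, hh⟩ | ⟨x, y, z, hh⟩
    · have hy : y ∈ I.map (LinearMap.snd K Pm Pp) := by rw [bp]; trivial
      obtain ⟨u, hu, rfl⟩ := hy
      exact hh (km u hu x z)
    · have hy : y ∈ I.map (LinearMap.fst K Pm Pp) := by rw [bm]; trivial
      obtain ⟨u, hu, rfl⟩ := hy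
      exact hh (kp u hu x z)

theorem simple_of_tri (KP : KantorPair K Pm Pp) (h : TSimple K (tri KP)) : KP.IsSimplePair := by
  obtain ⟨⟨a, b, c, habc⟩, h2⟩ := h
  refine ⟨?_, fun Qm Qp hQ => ?_⟩
  · by_contra hcon
    push Not at hcon
    exact habc (by simp [tri, hcon.1, hcon.2])
  · obtain ⟨q1, q2, q3, q4⟩ := hQ
    have hI : TIdeal (tri KP) (Qm.prod Qp) := by
      rintro u ⟨hu1, hu2⟩ a b
      refine ⟨⟨?_, ?_⟩, ⟨?_, ?_⟩, ⟨?_, ?_⟩⟩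
      · exact add_mem (sub_mem (q1 0 _ _ _ hu1).2 (q2 _ _ _ hu2))
          (sub_mem (q1 0 _ _ _ hu1).2 (q1 _ 0 _ _ hu1).1)
      · exact add_mem (sub_mem (q3 0 _ _ _ hu2).2 (q4 _ _ _ hu1))
          (sub_mem (q3 0 _ _ _ hu2).2 (q3 _ 0 _ _ hu2).1)
      · exact add_mem (sub_mem (q2 _ _ _ hu2) (q1 0 _ _ _ hu1).2)
          (sub_mem (q1 _ 0 _ _ hu1).1 (q1 0 _ _ _ hu1).2)
      · exact add_mem (sub_mem (q4 _ _ _ hu1) (q3 0 _ _ _ hu2).2)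
          (sub_mem (q3 _ 0 _ _ hu2).1 (q3 0 _ _ _ hu2).2)
      · exact add_mem (sub_mem (q1 _ 0 _ _ hu1).1 (q1 _ 0 _ _ hu1).1)
          (sub_mem (q2 _ _ _ hu2) (q2 _ _ _ hu2))
      · exact add_mem (sub_mem (q3 _ 0 _ _ hu2).1 (q3 _ 0 _ _ hu2).1)
          (sub_mem (q4 _ _ _ hu1) (q4 _ _ _ hu1))
    rcases h2 _ hI with h0 | h0
    · left
      exact (Submodule.prod_eq_bot_iff _ _ _).1 h0
    · right
      exact (Submodule.prod_eq_top_iff _ _ _).1 h0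

theorem central_of_tri (KP : KantorPair K Pm Pp) (h : TCentral K (tri KP)) :
    KP.IsCentralPair := by
  refine ⟨fun ωm ωp hω => ?_, fun a h1 h2 => ?_⟩
  · obtain ⟨hm, hp⟩ := hω
    obtain ⟨a, ha⟩ := h.1 (ωm.prodMap ωp) (by
      intro u v w
      simp only [tri, LinearMap.prodMap_apply, map_add, map_sub, Prod.mk.injEq]
      refine ⟨⟨?_, ?_⟩, ⟨?_, ?_⟩, ⟨?_, ?_⟩⟩
      · rw [(hm u.1 v.2 w.1).1, (hm v.1 u.2 w.1).2.1, (hm u.1 w.2 v.1).1, (hm v.1 w.2 u.1).2.2]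
      · rw [(hp u.2 v.1 w.2).1, (hp v.2 u.1 w.2).2.1, (hp u.2 w.1 v.2).1, (hp v.2 w.1 u.2).2.2]
      · rw [(hm u.1 v.2 w.1).2.1, (hm v.1 u.2 w.1).1, (hm u.1 w.2 v.1).2.2, (hm v.1 w.2 u.1).1]
      · rw [(hp u.2 v.1 w.2).2.1, (hp v.2 u.1 w.2).1, (hp u.2 w.1 v.2).2.2, (hp v.2 w.1 u.2).1]
      · rw [(hm u.1 v.2 w.1).2.2, (hm v.1 u.2 w.1).2.2, (hm u.1 w.2 v.1).2.1,
          (hm v.1 w.2 u.1).2.1]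
      · rw [(hp u.2 v.1 w.2).2.2, (hp v.2 u.1 w.2).2.2, (hp u.2 w.1 v.2).2.1,
          (hp v.2 w.1 u.2).2.1])
    refine ⟨a, LinearMap.ext fun x => ?_, LinearMap.ext fun x => ?_⟩
    · simpa using congrArg Prod.fst (LinearMap.congr_fun ha (x, 0))
    · simpa using congrArg Prod.snd (LinearMap.congr_fun ha (0, x))
  · apply h.2
    refine LinearMap.ext fun x => Prod.ext ?_ ?_
    · simpa using LinearMap.congr_fun h1 x.1
    · simpa using LinearMap.congr_fun h2 x.2

theorem perfect (KP : KantorPair K Pm Pp) (h : KP.IsSimplePair) :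
    Submodule.span K {w | ∃ x y z, w = KP.tm x y z} = ⊤ ∧
    Submodule.span K {w | ∃ x y z, w = KP.tp x y z} = ⊤ := by
  have hm : ∀ x y z, KP.tm x y z ∈ Submodule.span K {w | ∃ x y z, w = KP.tm x y z} :=
    fun x y z => Submodule.subset_span ⟨x, y, z, rfl⟩
  have hp : ∀ x y z, KP.tp x y z ∈ Submodule.span K {w | ∃ x y z, w = KP.tp x y z} :=
    fun x y z => Submodule.subset_span ⟨x, y, z, rfl⟩
  rcases h.2 _ _ (show KP.IsIdealPair _ _ from ⟨fun x z y q _ => ⟨hm _ _ _, hm _ _ _⟩,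
    fun x z r _ => hm _ _ _, fun x z y q _ => ⟨hp _ _ _, hp _ _ _⟩,
    fun x z r _ => hp _ _ _⟩) with ⟨b1, b2⟩ | h0
  · exfalso
    rcases h.1 with ⟨x, y, z, hh⟩ | ⟨x, y, z, hh⟩
    · have := hm x y z
      rw [b1] at this
      exact hh (by simpa using this)
    · have := hp x y z
      rw [b2] at this
      exact hh (by simpa using this)
  · exact h0

theorem tri_central_of (KP : KantorPair K Pm Pp) (hs : KP.IsSimplePair)
    (h : KP.IsCentralPair) : TCentral K (tri KP) := by
  obtain ⟨pm, pp⟩ := perfect KP hs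
  have e1 : ∀ x y z, tri KP (x, 0) (0, y) (z, 0) = (KP.tm x y z, 0) := by
    intros; simp [tri, tm_z1, tm_z2, tm_z3, tp_z1, tp_z2, tp_z3]
  have e2 : ∀ x y z, tri KP (0, x) (y, 0) (0, z) = (0, KP.tp x y z) := by
    intros; simp [tri, tm_z1, tm_z2, tm_z3, tp_z1, tp_z2, tp_z3]
  refine ⟨fun ω hω => ?_, fun a ha => h.2 a ?_ ?_⟩
  · have o1 : ∀ x : Pm, (ω (x, 0)).2 = 0 := by
      intro x
      have hx : x ∈ Submodule.span K {w | ∃ x y z, w = KP.tm x y z} := by rw [pm]; trivial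
      have hle : Submodule.span K {w | ∃ x y z, w = KP.tm x y z} ≤
          LinearMap.ker (LinearMap.snd K Pm Pp ∘ₗ ω ∘ₗ LinearMap.inl K Pm Pp) := by
        rw [Submodule.span_le]
        rintro _ ⟨x, y, z, rfl⟩
        have := (hω (x, 0) (0, y) (z, 0)).2.1
        rw [e1] at this
        simp [this, tri, tm_z1, tm_z2, tm_z3, tp_z1, tp_z2, tp_z3]
      simpa using hle hx
    have o2 : ∀ x : Pp, (ω (0, x)).1 = 0 := by
      intro x
      have hx : x ∈ Submodule.span K {w | ∃ x y z, w = KP.tp x y z} := by rw [pp]; trivial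
      have hle : Submodule.span K {w | ∃ x y z, w = KP.tp x y z} ≤
          LinearMap.ker (LinearMap.fst K Pm Pp ∘ₗ ω ∘ₗ LinearMap.inr K Pm Pp) := by
        rw [Submodule.span_le]
        rintro _ ⟨x, y, z, rfl⟩
        have := (hω (0, x) (y, 0) (0, z)).2.1
        rw [e2] at this
        simp [this, tri, tm_z1, tm_z2, tm_z3, tp_z1, tp_z2, tp_z3]
      simpa using hle hx
    obtain ⟨a, h1, h2⟩ := h.1 (LinearMap.fst K Pm Pp ∘ₗ ω ∘ₗ LinearMap.inl K Pm Pp)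
      (LinearMap.snd K Pm Pp ∘ₗ ω ∘ₗ LinearMap.inr K Pm Pp) (by
        refine ⟨fun x y z => ?_, fun x y z => ?_⟩
        · have := hω (x, 0) (0, y) (z, 0)
          rw [e1] at this
          obtain ⟨t1, t2, t3⟩ := this
          refine ⟨?_, ?_, ?_⟩
          · simpa [o1, o2, tri, tm_z1, tm_z2, tm_z3, tp_z1, tp_z2, tp_z3] using congrArg Prod.fst t1
          · simpa [o1, o2, tri, tm_z1, tm_z2, tm_z3, tp_z1, tp_z2, tp_z3] using congrArg Prod.fst t2
          · simpa [o1, o2, tri, tm_z1, tm_z2, tm_z3, tp_z1, tp_z2, tp_z3] using congrArg Prod.fst t3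
        · have := hω (0, x) (y, 0) (0, z)
          rw [e2] at this
          obtain ⟨t1, t2, t3⟩ := this
          refine ⟨?_, ?_, ?_⟩
          · simpa [o1, o2, tri, tm_z1, tm_z2, tm_z3, tp_z1, tp_z2, tp_z3] using congrArg Prod.snd t1
          · simpa [o1, o2, tri, tm_z1, tm_z2, tm_z3, tp_z1, tp_z2, tp_z3] using congrArg Prod.snd t2
          · simpa [o1, o2, tri, tm_z1, tm_z2, tm_z3, tp_z1, tp_z2, tp_z3] using congrArg Prod.snd t3)
    refine ⟨a, LinearMap.ext fun u => ?_⟩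
    have hu : u = (u.1, 0) + (0, u.2) := by simp
    have g1 : (ω (u.1, 0)).1 = a • u.1 := by simpa using LinearMap.congr_fun h1 u.1
    have g2 : (ω (0, u.2)).2 = a • u.2 := by simpa using LinearMap.congr_fun h2 u.2
    have hw : ω u = ω (u.1, 0) + ω (0, u.2) := by rw [← map_add, ← hu]
    rw [hw]
    refine Prod.ext ?_ ?_
    · simp [g1, o2]
    · simp [g2, o1]
  · refine LinearMap.ext fun x => ?_
    simpa using congrArg Prod.fst (LinearMap.congr_fun ha (x, 0))
  · refine LinearMap.ext fun x => ?_
    simpa using congrArg Prod.snd (LinearMap.congr_fun ha (0, x))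

/-! ### Enveloping algebras -/

theorem env_of_tight (KP : KantorPair K Pm Pp) {L : Type*} [LieRing L] [LieAlgebra K L]
    (fg : FiveGrading K L) (E : Envelops KP fg) (hT : Tight K fg) :
    IsEnv (tri KP) (E.em.coprod E.ep) := by
  have hr : LinearMap.range (E.em.coprod E.ep) = Tsub fg := by
    rw [LinearMap.range_coprod, E.range_m, E.range_p, Tsub]
  have hind : iSupIndep fg.g := fg.internal.submodule_iSupIndep
  have mm : ∀ x, E.em x ∈ fg.g (-1) := fun x => by rw [← E.range_m]; exact ⟨x, rfl⟩
  have mp : ∀ x, E.ep x ∈ fg.g 1 := fun x => by rw [← E.range_p]; exact ⟨x, rfl⟩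
  have z3 : ∀ x y z, ⁅⁅E.em x, E.em y⁆, E.em z⁆ = 0 := fun x y z => by
    have := fg.lie_mem _ _ _ _ (fg.lie_mem _ _ _ _ (mm x) (mm y)) (mm z)
    rw [fg.vanish _ (by norm_num)] at this
    simpa using this
  have z3' : ∀ x y z, ⁅⁅E.ep x, E.ep y⁆, E.ep z⁆ = 0 := fun x y z => by
    have := fg.lie_mem _ _ _ _ (fg.lie_mem _ _ _ _ (mp x) (mp y)) (mp z)
    rw [fg.vanish _ (by norm_num)] at this
    simpa using this
  have kk : ∀ x y z : L, ⁅⁅x, z⁆, y⁆ = ⁅⁅x, y⁆, z⁆ - ⁅⁅z, y⁆, x⁆ := fun x y z => by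
    rw [lie_lie, ← lie_skew x ⁅z, y⁆, ← lie_skew z ⁅x, y⁆]; abel
  have hbrk : brkSpan K (Tsub fg) (Tsub fg) ≤ ⨆ i ∈ ({-2, 0, 2} : Set ℤ), fg.g i := by
    have hin : ∀ i ∈ ({-2, 0, 2} : Set ℤ), fg.g i ≤ ⨆ i ∈ ({-2, 0, 2} : Set ℤ), fg.g i :=
      fun i hi => le_biSup fg.g hi
    refine Submodule.span_le.2 ?_
    rintro _ ⟨x, hx, y, hy, rfl⟩
    obtain ⟨x1, hx1, x2, hx2, rfl⟩ := Submodule.mem_sup.1 hx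
    obtain ⟨y1, hy1, y2, hy2, rfl⟩ := Submodule.mem_sup.1 hy
    rw [lie_add, add_lie, add_lie]
    refine add_mem (add_mem (hin (-2) (by simp) ?_) (hin 0 (by simp) ?_))
      (add_mem (hin 0 (by simp) ?_) (hin 2 (by simp) ?_))
    · simpa using fg.lie_mem _ _ _ _ hx1 hy1
    · simpa using fg.lie_mem _ _ _ _ hx2 hy1
    · simpa using fg.lie_mem _ _ _ _ hx1 hy2
    · simpa using fg.lie_mem _ _ _ _ hx2 hy2
  refine ⟨?_, ?_, ?_, ?_, ?_⟩
  · rw [injective_iff_map_eq_zero]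
    rintro ⟨x, y⟩ hxy
    rw [LinearMap.coprod_apply] at hxy
    have hd : Disjoint (fg.g (-1)) (fg.g 1) := hind.pairwiseDisjoint (by norm_num)
    have hx : E.em x = 0 := by
      refine (Submodule.disjoint_def.1 hd) _ (mm x) ?_
      rw [eq_neg_of_add_eq_zero_left hxy]
      exact neg_mem (mp y)
    have hy : E.ep y = 0 := by simpa [hx] using hxy
    exact Prod.ext (E.inj_m (by rw [hx]; simp)) (E.inj_p (by rw [hy]; simp))
  · intro a b c
    simp only [tri, LinearMap.coprod_apply, map_add, map_sub, E.compat_m, E.compat_p, lie_add,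
      add_lie, z3, z3']
    rw [← kk (E.em a.1) (E.ep c.2) (E.em b.1), ← kk (E.ep a.2) (E.em c.1) (E.ep b.2),
      ← lie_skew (E.em b.1) (E.ep a.2), ← lie_skew (E.ep b.2) (E.em a.1), neg_lie, neg_lie]
    abel
  · rw [hr]
    have hd := hind.disjoint_biSup_biSup (s := {-1, 1}) (t := {-2, 0, 2}) (by
      rw [Set.disjoint_left]
      intro i hi
      simp only [Set.mem_insert_iff, Set.mem_singleton_iff] at hi ⊢
      omega)
    refine hd.mono ?_ hbrk
    exact sup_le (le_biSup fg.g (by simp)) (le_biSup fg.g (by simp))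
  · rw [hr]; exact hT.1
  · rw [hr]; exact hT.2

/-! ### Reflection -/

/-- The linear identification `P̌⁻ ⊕ P̌⁺ ≃ P⁻ ⊕ P⁺` as a linear map. -/
def phiMap {KP : KantorPair K Pm Pp} (SP : SPGrading KP) :
    (((SP.Qp 0) × (SP.Qm 1)) × ((SP.Qm 0) × (SP.Qp 1))) →ₗ[K] (Pm × Pp) where
  toFun u := ((u.2.1 : Pm) + (u.1.2 : Pm), (u.1.1 : Pp) + (u.2.2 : Pp))
  map_add' u v := by
    refine Prod.ext ?_ ?_ <;> simp <;> abel
  map_smul' a u := by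
    refine Prod.ext ?_ ?_ <;> simp

theorem phi_bij {KP : KantorPair K Pm Pp} (SP : SPGrading KP) :
    Function.Bijective (phiMap SP) := by
  constructor
  · rw [injective_iff_map_eq_zero]
    rintro ⟨⟨a, b⟩, ⟨c, d⟩⟩ h
    have h1 : (c : Pm) + (b : Pm) = 0 := congrArg Prod.fst h
    have h2 : (a : Pp) + (d : Pp) = 0 := congrArg Prod.snd h
    have hc : (c : Pm) = 0 := (Submodule.disjoint_def.1 SP.disj_m) _ c.2 (by
      rw [eq_neg_of_add_eq_zero_left h1]; exact neg_mem b.2)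
    have ha : (a : Pp) = 0 := (Submodule.disjoint_def.1 SP.disj_p) _ a.2 (by
      rw [eq_neg_of_add_eq_zero_left h2]; exact neg_mem d.2)
    rw [hc, zero_add] at h1
    rw [ha, zero_add] at h2
    refine Prod.ext (Prod.ext ?_ ?_) (Prod.ext ?_ ?_) <;> exact Subtype.ext (by assumption)
  · rintro ⟨x, y⟩
    have hx : x ∈ SP.Qm 0 ⊔ SP.Qm 1 := by rw [SP.sup_m]; trivial
    have hy : y ∈ SP.Qp 0 ⊔ SP.Qp 1 := by rw [SP.sup_p]; trivial
    obtain ⟨x0, hx0, x1, hx1, rfl⟩ := Submodule.mem_sup.1 hx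
    obtain ⟨y0, hy0, y1, hy1, rfl⟩ := Submodule.mem_sup.1 hy
    exact ⟨((⟨y0, hy0⟩, ⟨x1, hx1⟩), (⟨x0, hx0⟩, ⟨y1, hy1⟩)), rfl⟩

theorem phi_tri (KP : KantorPair K Pm Pp) (SP : SPGrading KP)
    (KPc : KantorPair K ((SP.Qp 0) × (SP.Qm 1)) ((SP.Qm 0) × (SP.Qp 1)))
    (hrefl : IsReflection KP SP KPc) (a b c) :
    phiMap SP (tri KPc a b c) = tri KP (phiMap SP a) (phiMap SP b) (phiMap SP c) := by
  have m1 : ∀ (x z : SP.Qm 0) (y : SP.Qp 1), KP.tm x y z = 0 := fun x z y => by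
    have := SP.grade_m _ _ _ _ _ _ x.2 y.2 z.2
    rw [SP.vanish_m _ (by norm_num) (by norm_num)] at this
    simpa using this
  have m2 : ∀ (x z : SP.Qm 1) (y : SP.Qp 0), KP.tm x y z = 0 := fun x z y => by
    have := SP.grade_m _ _ _ _ _ _ x.2 y.2 z.2
    rw [SP.vanish_m _ (by norm_num) (by norm_num)] at this
    simpa using this
  have p1 : ∀ (x z : SP.Qp 0) (y : SP.Qm 1), KP.tp x y z = 0 := fun x z y => by
    have := SP.grade_p _ _ _ _ _ _ x.2 y.2 z.2
    rw [SP.vanish_p _ (by norm_num) (by norm_num)] at this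
    simpa using this
  have p2 : ∀ (x z : SP.Qp 1) (y : SP.Qm 0), KP.tp x y z = 0 := fun x z y => by
    have := SP.grade_p _ _ _ _ _ _ x.2 y.2 z.2
    rw [SP.vanish_p _ (by norm_num) (by norm_num)] at this
    simpa using this
  obtain ⟨rp, rm⟩ := hrefl
  refine Prod.ext ?_ ?_
  · simp only [phiMap, LinearMap.coe_mk, AddHom.coe_mk, tri, Prod.fst_add, Prod.snd_add,
      Prod.fst_sub, Prod.snd_sub, Submodule.coe_add, Submodule.coe_sub, (rp _ _ _).1,
      (rm _ _ _).2, KP.tm_add₁, KP.tm_add₂, KP.tm_add₃, m1, m2]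
    abel
  · simp only [phiMap, LinearMap.coe_mk, AddHom.coe_mk, tri, Prod.fst_add, Prod.snd_add,
      Prod.fst_sub, Prod.snd_sub, Submodule.coe_add, Submodule.coe_sub, (rp _ _ _).2,
      (rm _ _ _).1, KP.tp_add₁, KP.tp_add₂, KP.tp_add₃, p1, p2]
    abel

end Pair

end ReflAux

/-- Let `P` be an SP-graded Kantor pair and `P̌` its reflection.  Then
the Kantor Lie algebras `𝔎(P̌)` and `𝔎(P)` are isomorphic as ungraded Lie algebras
(`𝔎(P)` and `𝔎(P̌)` being represented by arbitrary tightly enveloping 5-graded Lie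
algebras); consequently `P` is simple iff `P̌` is simple, and `P` is central simple iff
`P̌` is central simple. -/
theorem statement12 {K : Type*} [CommRing K] (h6 : IsUnit (6 : K))
    {Pm Pp : Type*} [AddCommGroup Pm] [AddCommGroup Pp] [Module K Pm] [Module K Pp]
    (KP : KantorPair K Pm Pp) (SP : SPGrading KP)
    (KPc : KantorPair K ((SP.Qp 0) × (SP.Qm 1)) ((SP.Qm 0) × (SP.Qp 1)))
    (hrefl : IsReflection KP SP KPc) :
    (∀ (L : Type*) [LieRing L] [LieAlgebra K L] (fg : FiveGrading K L)
        (_ : Envelops KP fg), Tight K fg →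
      ∀ (L' : Type*) [LieRing L'] [LieAlgebra K L'] (fg' : FiveGrading K L')
        (_ : Envelops KPc fg'), Tight K fg' →
      Nonempty (L' ≃ₗ⁅K⁆ L)) ∧
    (KP.IsSimplePair ↔ KPc.IsSimplePair) ∧
    ((KP.IsSimplePair ∧ KP.IsCentralPair) ↔ (KPc.IsSimplePair ∧ KPc.IsCentralPair)) := by
  have hφ := ReflAux.phi_tri KP SP KPc hrefl
  let φ := LinearEquiv.ofBijective (ReflAux.phiMap SP) (ReflAux.phi_bij SP)
  have h1 : ∀ a b c, φ (ReflAux.tri KPc a b c) = ReflAux.tri KP (φ a) (φ b) (φ c) := hφ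
  have h2 : ∀ a b c, φ.symm (ReflAux.tri KP a b c)
      = ReflAux.tri KPc (φ.symm a) (φ.symm b) (φ.symm c) := by
    intro a b c
    apply φ.injective
    rw [h1]
    simp
  have hs : KP.IsSimplePair ↔ KPc.IsSimplePair :=
    ⟨fun h => ReflAux.simple_of_tri _ ((ReflAux.tri_simple_of _ h).transfer φ h1),
      fun h => ReflAux.simple_of_tri _ ((ReflAux.tri_simple_of _ h).transfer φ.symm h2)⟩
  refine ⟨?_, hs, ?_⟩
  · intro L _ _ fg E hT L' _ _ fg' E' hT'
    have e1 := (ReflAux.env_of_tight KP fg E hT).comp φ h1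
    have e2 := ReflAux.env_of_tight KPc fg' E' hT'
    exact ReflAux.env_iso _ _ e2 e1
  · constructor
    · rintro ⟨h, hc⟩
      exact ⟨hs.1 h,
        ReflAux.central_of_tri _ ((ReflAux.tri_central_of _ h hc).transfer φ h1)⟩
    · rintro ⟨h, hc⟩
      exact ⟨hs.2 h,
        ReflAux.central_of_tri _ ((ReflAux.tri_central_of _ h hc).transfer φ.symm h2)⟩
end
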